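/- For every integer n ≥ 1 and every n-vertex (4,1)-tree T, the graph G²_T (the graph 2-generated by T) contains every tree on n vertices. -/

import Mathlib

/-- A DFS-ordered rooted tree on the vertices `0, 1, …, N-1`, listed in DFS preorder
(the root is `0` and the children of each vertex are ordered by their labels).
It is encoded by its parent function: `parent j < j` for every non-root vertex `j`, and the
labelling is a DFS preorder exactly when the parent of each vertex `j ≥ 1` is `j - 1` or an
ancestor of `j - 1`. By convention `parent 0 = 0`. -/
structure DFSTree (N : ℕ) : Type where
  parent : ℕ → ℕ
  parent_zero : parent 0 = 0
  parent_lt : ∀ j, 0 < j → j < N → parent j < j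
  preorder_chain : ∀ j, 0 < j → j < N → ∃ k, parent^[k] (j - 1) = parent j

namespace DFSTree

variable {N : ℕ}

/-- The level `L u` of a vertex `u`: its distance to the root `0`. -/
noncomputable def level (T : DFSTree N) (u : ℕ) : ℕ :=
  sInf {k | T.parent^[k] u = 0}

/-- `D[u]`: the set of descendants of `u`, including `u` itself. -/
def descCl (T : DFSTree N) (u : ℕ) : Set ℕ :=
  {w | w < N ∧ ∃ k, T.parent^[k] w = u}

/-- `w ∈ D(u)`: `w` is a strict descendant of `u`. -/
def StrictDesc (T : DFSTree N) (u w : ℕ) : Prop :=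
  w ∈ T.descCl u ∧ w ≠ u

/-- `w` is a left-sibling of `u`. -/
def LeftSib (T : DFSTree N) (u w : ℕ) : Prop :=
  0 < w ∧ w < u ∧ T.parent w = T.parent u

/-- `w = l u` is the nearest left-cousin of `u`: the last vertex before `u` in the DFS order
having the same level as `u`. -/
def Nlc (T : DFSTree N) (u w : ℕ) : Prop :=
  w < u ∧ T.level w = T.level u ∧ ∀ c, w < c → c < u → T.level c ≠ T.level u

/-- `w = r u` is the nearest right-cousin of `u`: the first vertex after `u` in the DFS order
having the same level as `u`. -/
def Nrc (T : DFSTree N) (u w : ℕ) : Prop :=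
  u < w ∧ w < N ∧ T.level w = T.level u ∧ ∀ c, u < c → c < w → T.level c ≠ T.level u

/-- The arc relation generating `G^h_T`: rules (G1)–(G4). -/
def Arc (T : DFSTree N) (h : ℕ) (u w : ℕ) : Prop :=
  -- (G1) w ∈ D(u)
  T.StrictDesc u w
  -- (G2) w is a left-sibling of u, or a strict descendant of a left-sibling of u
  ∨ (∃ s, T.LeftSib u s ∧ (w = s ∨ T.StrictDesc s w))
  -- (G3) w = l(u*) (u* the parent of u), or a strict descendant of l(u*)
  ∨ (0 < u ∧ ∃ s, T.Nlc (T.parent u) s ∧ (w = s ∨ T.StrictDesc s w))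
  -- (G4) with u' the h-th ancestor of u
  ∨ (w = T.parent^[h] u
      ∨ T.Nlc (T.parent^[h] u) w
      ∨ T.Nrc (T.parent^[h] u) w
      ∨ (((∃ s, T.Nlc (T.parent^[h] u) s ∧ T.StrictDesc s w)
            ∨ T.StrictDesc (T.parent^[h] u) w
            ∨ (∃ s, T.Nrc (T.parent^[h] u) s ∧ T.StrictDesc s w))
          ∧ T.level w ≤ T.level u))

/-- The graph `G^h_T` that is `h`-generated by `T`, as a simple graph on `ℕ` all of whose
edges lie within the vertex set `{0, …, N-1}` of `T`. -/
def graph (T : DFSTree N) (h : ℕ) : SimpleGraph ℕ :=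
  SimpleGraph.fromRel (fun u w => u < N ∧ w < N ∧ T.Arc h u w)

/-- `T` is a `(K, s)`-tree: conditions (T1)–(T4), where `ν u = |D[u]|`. -/
def IsKSTree (T : DFSTree N) (K s : ℕ) : Prop :=
  ∀ u, u < N →
    -- (T1) if l(l(u)) exists then ν(l(l(u))) + ν(l(u)) ≥ ν(u)
    ((∀ a b, T.Nlc u a → T.Nlc a b →
        (T.descCl u).ncard ≤ (T.descCl b).ncard + (T.descCl a).ncard) ∧
     -- (T2) if l(u) exists then K·ν(l(u)) ≥ ν(u)
     (∀ a, T.Nlc u a → (T.descCl u).ncard ≤ K * (T.descCl a).ncard) ∧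
     -- (T3) if u is not the rightmost vertex of its level then ν(u) ≥ ν(u')
     -- for every u' with L(u') ≥ L(u) + s
     ((∃ w, u < w ∧ w < N ∧ T.level w = T.level u) →
        ∀ u', u' < N → T.level u + s ≤ T.level u' →
          (T.descCl u').ncard ≤ (T.descCl u).ncard) ∧
     -- (T4) if u has a child and l(u) exists then l(u) has a child
     ((∃ c, 0 < c ∧ c < N ∧ T.parent c = u) →
        ∀ a, T.Nlc u a → ∃ c', 0 < c' ∧ c' < N ∧ T.parent c' = a))

end DFSTree

/-- `a` is the last index before `u` having the same level as `u`. -/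
def IsLeft (L : ℕ → ℕ) (a u : ℕ) : Prop :=
  a < u ∧ L a = L u ∧ ∀ c, a < c → c < u → L c ≠ L u

/-- The numerical and adjacency data of a DFS-ordered tree used by the embedding argument:
levels `L`, sizes `sz` of descendant intervals, and a graph `G` on the indices. -/
structure Host (N : ℕ) where
  L : ℕ → ℕ
  sz : ℕ → ℕ
  G : SimpleGraph ℕ
  sz_pos : ∀ u, u < N → 1 ≤ sz u
  sz_le : ∀ u, u < N → u + sz u ≤ N
  lt_level : ∀ u w, u < N → u < w → w < u + sz u → L u < L w
  end_level : ∀ u, u < N → u + sz u < N → L (u + sz u) ≤ L u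
  step_level : ∀ j, j + 1 < N → L (j + 1) ≤ L j + 1
  dom : ∀ U lo q w, U < N → (lo = U ∨ IsLeft L lo U) → lo < q → q < U + sz U →
    L q = L U + 1 → lo < w → w < q + sz q → L U + 1 ≤ L w → w ≠ q → G.Adj q w
  near : ∀ a u q, u < N → IsLeft L a u → a < q → q < u + sz u → L q = L u + 1 → G.Adj q a
  desc : ∀ a w, a < N → a < w → w < a + sz a → G.Adj a w
  sz_le_add : ∀ a b u, u < N → IsLeft L a u → IsLeft L b a → sz u ≤ sz b + sz a
  sz_le_mul : ∀ a u, u < N → IsLeft L a u → sz u ≤ 4 * sz a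
  sz_mono : ∀ a u u', u < N → IsLeft L a u → u' < N → L a + 1 ≤ L u' → sz u' ≤ sz a

namespace Host

open Finset

variable {N : ℕ} (Ho : Host N)

lemma left_end_le {a u : ℕ} (hu : u < N) (h : IsLeft Ho.L a u) : a + Ho.sz a ≤ u := by
  by_contra hc
  have := Ho.lt_level a u (h.1.trans hu) h.1 (by omega)
  have := h.2.1
  omega

lemma level_lt_of_gap {a u : ℕ} (hu : u < N) (h : IsLeft Ho.L a u) :
    ∀ w, a + Ho.sz a ≤ w → w < u → Ho.L w < Ho.L u := by
  intro w hw
  have ha := h.1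
  have hl := h.2.1
  have hs := Ho.sz_pos a (by omega)
  induction w, hw using Nat.le_induction with
  | base =>
    intro hwu
    have h1 := Ho.end_level a (by omega) (by omega)
    have h2 := h.2.2 (a + Ho.sz a) (by omega) hwu
    omega
  | succ w hw ih =>
    intro hwu
    have h1 := ih (by omega)
    have h2 := Ho.step_level w (by omega)
    have h3 := h.2.2 (w + 1) (by omega) hwu
    omega

lemma exists_child {U m : ℕ} (hU : U < N) (hm : U + 1 < m) (hm' : m ≤ U + Ho.sz U) :
    ∃ p, U < p ∧ p < m ∧ m ≤ p + Ho.sz p ∧ Ho.L p = Ho.L U + 1 := by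
  classical
  have hN := Ho.sz_le U hU
  let F := (Ico (U + 1) m).filter (fun p => Ho.L p = Ho.L U + 1)
  have hF : F.Nonempty := by
    refine ⟨U + 1, ?_⟩
    have h1 := Ho.lt_level U (U + 1) hU (by omega) (by omega)
    have h2 := Ho.step_level U (by omega)
    simp only [F, mem_filter, mem_Ico]
    omega
  obtain ⟨p, hp, hmax⟩ := F.exists_max_image id hF
  simp only [F, mem_filter, mem_Ico, id] at hp hmax
  refine ⟨p, by omega, by omega, ?_, hp.2⟩
  by_contra hc
  have hs := Ho.sz_pos p (by omega)
  have h1 := Ho.end_level p (by omega) (by omega)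
  have h2 := Ho.lt_level U (p + Ho.sz p) hU (by omega) (by omega)
  have := hmax (p + Ho.sz p) ⟨⟨by omega, by omega⟩, by omega⟩
  omega

lemma exists_left {ℓ lo q w : ℕ} (hq : q < N) (hlo : Ho.L lo = ℓ) (hLq : Ho.L q = ℓ + 1)
    (h1 : lo < w) (h2 : w < q) (hw : ℓ + 1 ≤ Ho.L w) : ∃ a, IsLeft Ho.L a q ∧ lo < a := by
  classical
  let F := (Ioo lo q).filter (fun p => Ho.L p = ℓ + 1)
  have hF : F.Nonempty := by
    have hex : ∃ x, lo < x ∧ ℓ + 1 ≤ Ho.L x := ⟨w, h1, hw⟩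
    obtain ⟨x, hx, hxw, hmin⟩ : ∃ x, (lo < x ∧ ℓ + 1 ≤ Ho.L x) ∧ x ≤ w ∧
        ∀ y < x, ¬ (lo < y ∧ ℓ + 1 ≤ Ho.L y) :=
      ⟨Nat.find hex, Nat.find_spec hex, Nat.find_min' hex ⟨h1, hw⟩,
        fun y hy => Nat.find_min hex hy⟩
    refine ⟨x, ?_⟩
    simp only [F, mem_filter, mem_Ioo]
    refine ⟨⟨hx.1, by omega⟩, ?_⟩
    obtain ⟨y, rfl⟩ : ∃ y, x = y + 1 := ⟨x - 1, by omega⟩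
    have h3 := Ho.step_level y (by omega)
    have h4 : Ho.L y ≤ ℓ := by
      by_cases hy : y = lo
      · rw [hy, hlo]
      · have := hmin y (by omega)
        by_contra hc
        exact this ⟨by omega, by omega⟩
    omega
  obtain ⟨p, hp, hmax⟩ := F.exists_max_image id hF
  simp only [F, mem_filter, mem_Ioo, id] at hp hmax
  refine ⟨p, ⟨hp.1.2, by omega, ?_⟩, hp.1.1⟩
  intro c hc hcq heq
  have := hmax c ⟨⟨by omega, hcq⟩, by omega⟩
  omega

/-- The indices in `[x, y)` of level at least `ℓ`. -/
def Lv (ℓ x y : ℕ) : Finset ℕ := (Ico x y).filter (fun w => ℓ ≤ Ho.L w)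

lemma mem_Lv {ℓ x y w : ℕ} : w ∈ Ho.Lv ℓ x y ↔ (x ≤ w ∧ w < y) ∧ ℓ ≤ Ho.L w := by
  simp [Lv]

lemma Lv_eq_Ico {ℓ x y : ℕ} (h : ∀ w, x ≤ w → w < y → ℓ ≤ Ho.L w) :
    Ho.Lv ℓ x y = Ico x y := by
  ext w
  simp only [mem_Lv, mem_Ico]
  exact ⟨fun h => h.1, fun hw => ⟨hw, h w hw.1 hw.2⟩⟩

lemma le_level {u w : ℕ} (hu : u < N) (h1 : u ≤ w) (h2 : w < u + Ho.sz u) :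
    Ho.L u ≤ Ho.L w := by
  rcases h1.eq_or_lt with rfl | h1
  · exact le_rfl
  · exact (Ho.lt_level u w hu h1 h2).le

lemma Lv_child {u x m : ℕ} (hu : u < N) (hx : u < x) (hm : m ≤ u + Ho.sz u) :
    Ho.Lv (Ho.L u + 1) x m = Ico x m :=
  Ho.Lv_eq_Ico fun w h1 h2 => Ho.lt_level u w hu (by omega) (by omega)

/-- Strict descendants of two consecutive cousins. -/
lemma Lv_two {a u x m : ℕ} (hu : u < N) (h : IsLeft Ho.L a u) (hx : a < x) (hxu : x ≤ u + 1) (hum : u < m)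
    (hm' : m ≤ u + Ho.sz u) :
    Ho.Lv (Ho.L u + 1) x m = Ioo u m ∪ Ico x (a + Ho.sz a) := by
  have hau := Ho.left_end_le hu h
  ext w
  simp only [mem_Lv, mem_union, mem_Ioo, mem_Ico]
  constructor
  · rintro ⟨⟨h1, h2⟩, h3⟩
    by_cases hw : w < a + Ho.sz a
    · exact Or.inr ⟨h1, hw⟩
    · left
      refine ⟨?_, h2⟩
      by_contra hc
      rcases (Nat.lt_or_ge w u) with h4 | h4
      · have := Ho.level_lt_of_gap hu h w (by omega) h4
        omega
      · have : w = u := by omega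
        subst this
        omega
  · rintro (⟨h1, h2⟩ | ⟨h1, h2⟩)
    · exact ⟨⟨by omega, h2⟩, Ho.lt_level u w hu h1 (by omega)⟩
    · refine ⟨⟨h1, by omega⟩, ?_⟩
      rw [← h.2.1]
      exact Ho.lt_level a w (by omega) (by omega) h2

end Host

set_option linter.unusedSectionVars false

section Guest

open Finset

variable {V : Type*} [DecidableEq V]

/-- `X` and `Y` are disjoint and no edge of `H` joins them. -/
def Apart (H : SimpleGraph V) (X Y : Finset V) : Prop :=
  ∀ v ∈ X, ∀ w ∈ Y, v ≠ w ∧ ¬ H.Adj v w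

/-- `f` embeds `H[R]` into `G`, with image exactly `P`. -/
structure Emb (H : SimpleGraph V) (G : SimpleGraph ℕ) (f : V → ℕ) (R : Finset V)
    (P : Finset ℕ) : Prop where
  inj : Set.InjOn f R
  img : R.image f = P
  adj : ∀ v ∈ R, ∀ w ∈ R, H.Adj v w → G.Adj (f v) (f w)

/-- `X` cannot be split into two nonempty separated parts. -/
def Conn (H : SimpleGraph V) (X : Finset V) : Prop :=
  ∀ Y, Apart H (X ∩ Y) (X \ Y) → X ⊆ Y ∨ Disjoint X Y

variable {H : SimpleGraph V} {G : SimpleGraph ℕ}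

lemma Apart.symm {X Y : Finset V} (h : Apart H X Y) : Apart H Y X :=
  fun v hv w hw => ⟨(h w hw v hv).1.symm, fun ha => (h w hw v hv).2 ha.symm⟩

lemma Apart.disjoint {X Y : Finset V} (h : Apart H X Y) : Disjoint X Y :=
  disjoint_left.2 fun v hv hw => (h v hv v hw).1 rfl

lemma Apart.mono {X Y X' Y' : Finset V} (h : Apart H X Y) (hX : X' ⊆ X) (hY : Y' ⊆ Y) :
    Apart H X' Y' :=
  fun v hv w hw => h v (hX hv) w (hY hw)

lemma Apart.union_right {X Y Z : Finset V} (h : Apart H X Y) (h' : Apart H X Z) : Apart H X (Y ∪ Z) := by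
  intro v hv w hw
  rcases mem_union.1 hw with hw | hw
  exacts [h v hv w hw, h' v hv w hw]

lemma Apart.union_left {X Y Z : Finset V} (h : Apart H X Z) (h' : Apart H Y Z) : Apart H (X ∪ Y) Z :=
  (h.symm.union_right h'.symm).symm

lemma Apart.biUnion_right {ι : Type*} {X : Finset V} {J : Finset ι} {P : ι → Finset V}
    (h : ∀ c ∈ J, Apart H X (P c)) : Apart H X (J.biUnion P) := by
  intro v hv w hw
  obtain ⟨c, hc, hw⟩ := mem_biUnion.1 hw
  exact h c hc v hv w hw

namespace Emb

variable {f : V → ℕ} {R : Finset V} {P : Finset ℕ}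

lemma mem (h : Emb H G f R P) {v : V} (hv : v ∈ R) : f v ∈ P :=
  h.img ▸ mem_image_of_mem f hv

lemma card_eq (h : Emb H G f R P) : R.card = P.card := by
  rw [← h.img, card_image_of_injOn h.inj]

lemma empty (f : V → ℕ) : Emb H G f ∅ ∅ := ⟨by simp, by simp, by simp⟩

lemma singleton (v : V) (x : ℕ) : Emb H G (fun _ => x) {v} {x} :=
  ⟨by simp, by simp, by
    intro a ha b hb hab
    simp only [mem_singleton] at ha hb
    subst ha hb
    exact absurd hab (H.irrefl)⟩

lemma union {g : V → ℕ} {R' : Finset V} {P' : Finset ℕ} (h : Emb H G f R P)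
    (h' : Emb H G g R' P') (hR : Disjoint R R') (hP : Disjoint P P')
    (hc : ∀ v ∈ R, ∀ w ∈ R', H.Adj v w → G.Adj (f v) (g w)) :
    ∃ k, Emb H G k (R ∪ R') (P ∪ P') ∧ (∀ v ∈ R, k v = f v) ∧ (∀ v ∈ R', k v = g v) := by
  classical
  let k : V → ℕ := fun v => if v ∈ R then f v else g v
  have k1 : ∀ v ∈ R, k v = f v := fun v hv => if_pos hv
  have k2 : ∀ v ∈ R', k v = g v := fun v hv => if_neg (disjoint_right.1 hR hv)
  refine ⟨k, ⟨?_, ?_, ?_⟩, k1, k2⟩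
  · intro v hv w hw hvw
    simp only [coe_union, Set.mem_union, mem_coe] at hv hw
    rcases hv with hv | hv <;> rcases hw with hw | hw
    · rw [k1 v hv, k1 w hw] at hvw
      exact h.inj hv hw hvw
    · rw [k1 v hv, k2 w hw] at hvw
      exact absurd (hvw ▸ h'.mem hw) (disjoint_left.1 hP (h.mem hv))
    · rw [k2 v hv, k1 w hw] at hvw
      exact absurd (hvw ▸ h'.mem hv) (disjoint_left.1 hP (h.mem hw))
    · rw [k2 v hv, k2 w hw] at hvw
      exact h'.inj hv hw hvw
  · rw [image_union, image_congr (g := f), image_congr (f := k) (g := g), h.img, h'.img]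
    · exact fun v hv => k2 v hv
    · exact fun v hv => k1 v hv
  · intro v hv w hw hvw
    rcases mem_union.1 hv with hv | hv <;> rcases mem_union.1 hw with hw | hw
    · rw [k1 v hv, k1 w hw]
      exact h.adj v hv w hw hvw
    · rw [k1 v hv, k2 w hw]
      exact hc v hv w hw hvw
    · rw [k2 v hv, k1 w hw]
      exact (hc w hw v hv hvw.symm).symm
    · rw [k2 v hv, k2 w hw]
      exact h'.adj v hv w hw hvw

lemma congr_sets {R' : Finset V} {P' : Finset ℕ} (h : Emb H G f R P) (hR : R = R')
    (hP : P = P') : Emb H G f R' P' := hR ▸ hP ▸ h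

end Emb

/-- A parent function `par` on `S`, rooted at `z`, decreasing `rk`, such that every edge of `H[S]`
joins a vertex to its parent. -/
structure Rooted (H : SimpleGraph V) (S : Finset V) (z : V) (par : V → V) (rk : V → ℕ) :
    Prop where
  root_mem : z ∈ S
  par_root : par z = z
  par_mem : ∀ v ∈ S, par v ∈ S
  rk_lt : ∀ v ∈ S, v ≠ z → rk (par v) < rk v
  adj_par : ∀ v ∈ S, par v ≠ z → H.Adj v (par v)
  edge : ∀ v ∈ S, ∀ w ∈ S, H.Adj v w → par v = w ∨ par w = v

open Classical in
/-- The part of `S` lying below `w`. -/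
noncomputable def below (S : Finset V) (par : V → V) (w : V) : Finset V :=
  S.filter (fun v => ∃ k, par^[k] v = w)

/-- The children of `x`. -/
def kids (S : Finset V) (z : V) (par : V → V) (x : V) : Finset V :=
  S.filter (fun c => c ≠ z ∧ par c = x)

namespace Rooted

variable {S : Finset V} {z : V} {par : V → V} {rk : V → ℕ}

lemma mem_below {v w : V} : v ∈ below S par w ↔ v ∈ S ∧ ∃ k, par^[k] v = w := by
  simp [below]

lemma mem_kids {x c : V} : c ∈ kids S z par x ↔ c ∈ S ∧ c ≠ z ∧ par c = x := by
  simp [kids]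

lemma below_subset (w : V) : below S par w ⊆ S := fun _ hv => (mem_below.1 hv).1

lemma self_mem_below {w : V} (hw : w ∈ S) : w ∈ below S par w := mem_below.2 ⟨hw, 0, rfl⟩

lemma mem_below_of_par {v w : V} (hv : v ∈ S) (h : par v ∈ below S par w) :
    v ∈ below S par w := by
  obtain ⟨-, k, hk⟩ := mem_below.1 h
  exact mem_below.2 ⟨hv, k + 1, hk⟩

lemma par_mem_below (h : Rooted H S z par rk) {v w : V} (hv : v ∈ below S par w) (hvw : v ≠ w) :
    par v ∈ below S par w := by
  obtain ⟨hvS, k, hk⟩ := mem_below.1 hv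
  cases k with
  | zero => exact absurd hk hvw
  | succ k => exact mem_below.2 ⟨h.par_mem v hvS, k, hk⟩

lemma root_not_mem (h : Rooted H S z par rk) {w : V} (hw : w ≠ z) : z ∉ below S par w := by
  intro hz
  obtain ⟨-, k, hk⟩ := mem_below.1 hz
  rw [Function.iterate_fixed h.par_root] at hk
  exact hw hk.symm

lemma below_root (h : Rooted H S z par rk) : below S par z = S := by
  refine Subset.antisymm (below_subset z) ?_
  have : ∀ n, ∀ v ∈ S, rk v ≤ n → v ∈ below S par z := by
    intro n
    induction n with
    | zero =>
      intro v hv hn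
      by_cases hvz : v = z
      · exact hvz ▸ self_mem_below hv
      · have := h.rk_lt v hv hvz
        omega
    | succ n ih =>
      intro v hv hn
      by_cases hvz : v = z
      · exact hvz ▸ self_mem_below hv
      · have := h.rk_lt v hv hvz
        exact mem_below_of_par hv (ih _ (h.par_mem v hv) (by omega))
  exact fun v hv => this _ v hv le_rfl

lemma below_trans {x w : V} (hx : x ∈ below S par w) : below S par x ⊆ below S par w := by
  intro v hv
  obtain ⟨-, k, hk⟩ := mem_below.1 hx
  obtain ⟨hvS, j, hj⟩ := mem_below.1 hv
  refine mem_below.2 ⟨hvS, k + j, ?_⟩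
  rw [Function.iterate_add_apply, hj, hk]

lemma rk_le (h : Rooted H S z par rk) {v w : V} (hv : v ∈ below S par w) :
    rk w ≤ rk v := by
  obtain ⟨hvS, k, hk⟩ := mem_below.1 hv
  clear hv
  induction k generalizing v with
  | zero => exact (congrArg rk hk).ge
  | succ k ih =>
    refine (ih (h.par_mem v hvS) hk).trans ?_
    by_cases hvz : v = z
    · rw [hvz, h.par_root]
    · exact (h.rk_lt v hvS hvz).le

lemma kid_mem_below {x c : V} (hx : x ∈ S) (hc : c ∈ kids S z par x) : c ∈ below S par x := by
  obtain ⟨h1, -, h3⟩ := mem_kids.1 hc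
  exact mem_below_of_par h1 (h3 ▸ self_mem_below (h3 ▸ hx))

lemma not_mem_below_kid (h : Rooted H S z par rk) {x c : V} (hc : c ∈ kids S z par x) :
    x ∉ below S par c := by
  intro hx
  obtain ⟨h1, h2, h3⟩ := mem_kids.1 hc
  have := h.rk_le hx
  have := h.rk_lt c h1 h2
  rw [h3] at this
  omega

lemma exists_kid (h : Rooted H S z par rk) {x v : V} (hv : v ∈ below S par x) (hvx : v ≠ x) :
    ∃ c ∈ kids S z par x, v ∈ below S par c := by
  obtain ⟨hvS, k, hk⟩ := mem_below.1 hv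
  clear hv
  induction k generalizing v with
  | zero => exact absurd hk hvx
  | succ k ih =>
    by_cases hp : par v = x
    · have hvz : v ≠ z := by
        rintro rfl
        exact hvx (h.par_root.symm.trans hp)
      exact ⟨v, mem_kids.2 ⟨hvS, hvz, hp⟩, self_mem_below hvS⟩
    · obtain ⟨c, hc, hv⟩ := ih hp (h.par_mem v hvS) hk
      exact ⟨c, hc, mem_below_of_par hvS hv⟩

lemma edge_out (h : Rooted H S z par rk) {c v w : V} (hv : v ∈ below S par c) (hw : w ∈ S)
    (hwc : w ∉ below S par c) (ha : H.Adj v w) : v = c ∧ w = par c := by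
  rcases h.edge v (below_subset _ hv) w hw ha with h1 | h1
  · by_cases hvc : v = c
    · exact ⟨hvc, by rw [← hvc, h1]⟩
    · exact absurd (h1 ▸ h.par_mem_below hv hvc) hwc
  · exact absurd (mem_below_of_par hw (h1 ▸ hv)) hwc

lemma kids_disjoint (h : Rooted H S z par rk) {x c d : V} (hc : c ∈ kids S z par x)
    (hd : d ∈ kids S z par x) (hcd : c ≠ d) : Disjoint (below S par c) (below S par d) := by
  rw [disjoint_left]
  intro v hv hv'
  obtain ⟨hvS, i, hi⟩ := mem_below.1 hv
  obtain ⟨-, j, hj⟩ := mem_below.1 hv'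
  have key : ∀ {c d : V} {i j : ℕ}, c ∈ kids S z par x → d ∈ kids S z par x → c ≠ d →
      par^[i] v = c → par^[j] v = d → i ≤ j → False := by
    intro c d i j hc hd hcd hi hj hij
    obtain ⟨k, rfl⟩ := Nat.exists_eq_add_of_le hij
    have : c ∈ below S par d := by
      refine mem_below.2 ⟨(mem_kids.1 hc).1, k, ?_⟩
      rw [← hj, ← hi, ← Function.iterate_add_apply, add_comm]
    have := h.par_mem_below this hcd
    rw [(mem_kids.1 hc).2.2] at this
    exact h.not_mem_below_kid hd this
  rcases le_total i j with hij | hij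
  · exact key hc hd hcd hi hj hij
  · exact key hd hc hcd.symm hj hi hij

lemma kids_sep (h : Rooted H S z par rk) {x c d : V} (hc : c ∈ kids S z par x)
    (hd : d ∈ kids S z par x) (hcd : c ≠ d) : Apart H (below S par c) (below S par d) := by
  have hdis := h.kids_disjoint hc hd hcd
  intro v hv w hw
  refine ⟨fun e => disjoint_left.1 hdis hv (e ▸ hw), fun ha => ?_⟩
  have := (h.edge_out hv (below_subset _ hw) (disjoint_right.1 hdis hw) ha).2
  rw [(mem_kids.1 hc).2.2] at this
  exact h.not_mem_below_kid hd (this ▸ hw)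

lemma below_eq (h : Rooted H S z par rk) {x : V} (hx : x ∈ S) :
    below S par x = insert x ((kids S z par x).biUnion (below S par)) := by
  ext v
  simp only [mem_insert, mem_biUnion]
  constructor
  · intro hv
    by_cases hvx : v = x
    · exact Or.inl hvx
    · exact Or.inr (h.exists_kid hv hvx)
  · rintro (rfl | ⟨c, hc, hv⟩)
    · exact self_mem_below hx
    · exact below_trans (kid_mem_below hx hc) hv

lemma card_biUnion_kids (h : Rooted H S z par rk) {x : V} {J : Finset V}
    (hJ : J ⊆ kids S z par x) :
    (J.biUnion (below S par)).card = ∑ c ∈ J, (below S par c).card :=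
  card_biUnion fun _ hc _ hd hcd => h.kids_disjoint (hJ hc) (hJ hd) hcd

lemma card_below (h : Rooted H S z par rk) {x : V} (hx : x ∈ S) :
    (below S par x).card = 1 + ∑ c ∈ kids S z par x, (below S par c).card := by
  rw [h.below_eq hx, card_insert_of_notMem, h.card_biUnion_kids Subset.rfl, add_comm]
  intro hm
  obtain ⟨c, hc, hv⟩ := mem_biUnion.1 hm
  exact h.not_mem_below_kid hc hv

lemma conn_below (h : Rooted H S z par rk) {c : V} (hc : c ≠ z) :
    Conn H (below S par c) := by
  intro Y hY
  have key : ∀ k, ∀ v ∈ S, par^[k] v = c → (v ∈ Y ↔ c ∈ Y) := by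
    intro k
    induction k with
    | zero =>
      intro v _ hv
      rw [show v = c from hv]
    | succ k ih =>
      intro v hvS hv
      rw [← ih (par v) (h.par_mem v hvS) hv]
      have hp : par v ∈ below S par c := mem_below.2 ⟨h.par_mem v hvS, k, hv⟩
      have hv' : v ∈ below S par c := mem_below.2 ⟨hvS, k + 1, hv⟩
      have hne : par v ≠ z := fun e => h.root_not_mem hc (e ▸ hp)
      have ha := h.adj_par v hvS hne
      by_contra hcon
      by_cases hvY : v ∈ Y
      · have hpY : par v ∉ Y := fun hpY => hcon (by simp [hvY, hpY])
        exact (hY v (by simp [hvY, hv']) (par v) (by simp [hp, hpY])).2 ha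
      · have hpY : par v ∈ Y := by
          by_contra hpY
          exact hcon (by simp [hvY, hpY])
        exact (hY (par v) (by simp [hpY, hp]) v (by simp [hvY, hv'])).2 ha.symm
  by_cases hcY : c ∈ Y
  · left
    intro v hv
    obtain ⟨hvS, k, hk⟩ := mem_below.1 hv
    exact (key k v hvS hk).2 hcY
  · right
    rw [disjoint_left]
    intro v hv hvY
    obtain ⟨hvS, k, hk⟩ := mem_below.1 hv
    exact hcY ((key k v hvS hk).1 hvY)

end Rooted

/-- Every induced subgraph of a tree can be rooted. -/
lemma exists_rooted (hH : H.IsTree) {S : Finset V} {z : V} (hz : z ∈ S) :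
    ∃ par rk, Rooted H S z par rk := by
  classical
  have hcl : ∀ v w w', H.Adj v w → H.Adj v w' → H.dist z w + 1 = H.dist z v →
      H.dist z w' + 1 = H.dist z v → w = w' := by
    intro v w w' h1 h2 h3 h4
    have hp : ∀ w, (h : H.Adj v w) → H.dist z w + 1 = H.dist z v →
        ∃ p : H.Walk z v, p.IsPath ∧ p.penultimate = w := by
      intro w h h3
      obtain ⟨p, hp⟩ := hH.connected.exists_walk_length_eq_dist z w
      refine ⟨p.concat h.symm, ?_, by simp⟩
      apply SimpleGraph.Walk.isPath_of_length_eq_dist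
      simp [hp, h3]
    obtain ⟨p, hpp, hp1⟩ := hp w h1 h3
    obtain ⟨q, hq, hq'⟩ := hp w' h2 h4
    have := hH.existsUnique_path z v
    rw [← hp1, ← hq', this.unique hpp hq]
  let P : V → V → Prop := fun v w => v ∈ S ∧ w ∈ S ∧ H.Adj v w ∧ H.dist z w + 1 = H.dist z v
  let par : V → V := fun v => if h : ∃ w, P v w then h.choose else z
  have par_pos : ∀ v w, P v w → par v = w := by
    intro v w h
    have hex : ∃ w, P v w := ⟨w, h⟩
    have : par v = hex.choose := dif_pos hex
    rw [this]
    have hs := hex.choose_spec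
    exact hcl v _ _ hs.2.2.1 h.2.2.1 hs.2.2.2 h.2.2.2
  have par_or : ∀ v, P v (par v) ∨ par v = z := by
    intro v
    by_cases hex : ∃ w, P v w
    · left
      have : par v = hex.choose := dif_pos hex
      rw [this]
      exact hex.choose_spec
    · exact Or.inr (dif_neg hex)
  refine ⟨par, H.dist z, hz, ?_, ?_, ?_, ?_, ?_⟩
  · rcases par_or z with h | h
    · have := h.2.2.2
      simp at this
    · exact h
  · intro v _
    rcases par_or v with h | h
    · exact h.2.1
    · rwa [h]
  · intro v _ hv
    rcases par_or v with h | h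
    · have := h.2.2.2
      omega
    · rw [h, SimpleGraph.dist_self]
      exact hH.connected.pos_dist_of_ne hv.symm
  · intro v _ hv
    rcases par_or v with h | h
    · exact h.2.2.1
    · exact absurd h hv
  · intro v hv w hw ha
    rcases hH.dist_eq_dist_add_one_of_adj z ha with h | h
    · exact Or.inl (par_pos v w ⟨hv, hw, ha, h.symm⟩)
    · exact Or.inr (par_pos w v ⟨hw, hv, ha.symm, h.symm⟩)

end Guest

section Filling

open Finset

variable {V : Type*} [DecidableEq V] {N : ℕ} (Ho : Host N) (H : SimpleGraph V)

/-- Below the window `(lo, m)`, some part `Us` of `S` fills the top indices of level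
greater than `L U`, leaving only through indices of level `L U + 1`. -/
def StepAt (U : ℕ) : Prop :=
  U < N → ∀ (lo p m : ℕ) (S : Finset V) (z : V), (lo = U ∨ IsLeft Ho.L lo U) →
    U < p → p < m → m ≤ p + Ho.sz p → m ≤ U + Ho.sz U → Ho.L p = Ho.L U + 1 →
    z ∈ S → m ≤ p + S.card → S.card ≤ (Ho.Lv (Ho.L U + 1) (lo + 1) m).card →
    ∃ Us ⊆ S, ∃ f m', lo < m' ∧ m' ≤ p ∧ Emb H Ho.G f Us (Ho.Lv (Ho.L U + 1) m' m) ∧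
      (∀ v ∈ Us, ∀ w ∈ S \ Us, H.Adj v w → Ho.L (f v) = Ho.L U + 1) ∧
      (z ∈ Us → Ho.L (f z) = Ho.L U + 1) ∧
      ((∀ X ⊆ S, Conn H X → X.card + p < m) → z ∈ Us)

/-- `R` embeds onto the indices of `(u, m)` and a final segment of the strict descendants of `a`,
with the vertices of `ζ` landing on neighbours of `a`. -/
def Good (u a m : ℕ) (R ζ : Finset V) : Prop :=
  ∃ f m1, a < m1 ∧ m1 ≤ a + Ho.sz a ∧
    Emb H Ho.G f R (Ioo u m ∪ Ico m1 (a + Ho.sz a)) ∧ ∀ z ∈ ζ, Ho.G.Adj (f z) a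

variable {Ho H}

lemma fill_one {U : ℕ} {ℓ : ℕ} (hS : ∀ U, ℓ ≤ Ho.L U → StepAt Ho H U) (hℓ : ℓ ≤ Ho.L U)
    (hU : U < N) {m : ℕ} (h2 : m ≤ U + Ho.sz U) {S : Finset V}
    (hc : S.card + U + 1 ≤ m) : ∃ f, Emb H Ho.G f S (Ico (m - S.card) m) := by
  induction hn : m - U using Nat.strong_induction_on generalizing m U S with
  | _ n ih =>
    rcases S.eq_empty_or_nonempty with rfl | ⟨z, hz⟩
    · exact ⟨fun _ => 0, by simpa using Emb.empty _⟩
    have hpos : 0 < S.card := card_pos.2 ⟨z, hz⟩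
    obtain ⟨p, hp1, hp2, hp3, hp4⟩ := Ho.exists_child hU (by omega) h2
    have hN := Ho.sz_le U hU
    by_cases hcp : m ≤ p + S.card
    · have hcard : (Ho.Lv (Ho.L U + 1) (U + 1) m).card = m - (U + 1) := by
        rw [Ho.Lv_child hU (by omega) h2, Nat.card_Ico]
      obtain ⟨Us, hUs, f, m', hm1, hm2, hf, hout, -, -⟩ := hS U hℓ hU U p m S z (Or.inl rfl) hp1
        hp2 hp3 h2 hp4 hz hcp (by omega)
      rw [Ho.Lv_child hU hm1 h2] at hf
      have hcU := hf.card_eq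
      rw [Nat.card_Ico] at hcU
      have hcS := card_sdiff_add_card_eq_card hUs
      obtain ⟨g, hg⟩ := ih (m' - U) (by omega) hℓ hU
        (show m' ≤ U + Ho.sz U by omega) (show (S \ Us).card + U + 1 ≤ m' by omega) rfl
      obtain ⟨k, hk, -, -⟩ := hf.union hg disjoint_sdiff (by
        rw [disjoint_left]
        intro x hx hx'
        rw [mem_Ico] at hx hx'
        omega) (by
        intro v hv w hw hvw
        have h3 := mem_Ico.1 (hf.mem hv)
        have h4 := mem_Ico.1 (hg.mem hw)
        exact Ho.dom U U _ _ hU (Or.inl rfl) (by omega) (by omega) (hout v hv w hw hvw) (by omega)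
          (by omega) (Ho.lt_level U _ hU (by omega) (by omega)) (by omega))
      refine ⟨k, hk.congr_sets (union_sdiff_of_subset hUs) ?_⟩
      ext x
      simp only [mem_union, mem_Ico]
      omega
    · exact ih (m - p) (by omega) (U := p) (by omega) (by omega) hp3 (by omega) rfl

variable {a u : ℕ}

lemma Good.card_eq {m : ℕ} {R : Finset V} (hu : u < N) (hl : IsLeft Ho.L a u)
    {f : V → ℕ} {m1 : ℕ} (h : Emb H Ho.G f R (Ioo u m ∪ Ico m1 (a + Ho.sz a))) :
    R.card = (m - u - 1) + (a + Ho.sz a - m1) := by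
  rw [h.card_eq, card_union_of_disjoint, Nat.card_Ioo, Nat.card_Ico]
  rw [disjoint_left]
  intro x hx hx'
  have := Ho.left_end_le hu hl
  rw [mem_Ioo] at hx
  rw [mem_Ico] at hx'
  omega

/-- Peel off one part of a vertex set below a child `p` of `u`. -/
lemma peel (hS : ∀ U, Ho.L u ≤ Ho.L U → StepAt Ho H U) (hu : u < N) (hl : IsLeft Ho.L a u)
    {p m : ℕ} (hp1 : u < p) (hp2 : p < m) (hp3 : m ≤ p + Ho.sz p) (hp4 : Ho.L p = Ho.L u + 1)
    (hm : m ≤ u + Ho.sz u) {S1 : Finset V} {z1 : V} (hz1 : z1 ∈ S1) (hc1 : m ≤ p + S1.card)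
    (hc2 : S1.card + u + 2 ≤ m + Ho.sz a) :
    ∃ Us ⊆ S1, ∃ m1 < m, ((∀ X ⊆ S1, Conn H X → X.card + p < m) → z1 ∈ Us) ∧
      ((u < m1 ∧ Us.card + m1 = m ∧ ∀ R ζ, S1 ⊆ R → ζ ⊆ R → Apart H S1 (R \ S1) →
          ζ ∩ S1 ⊆ {z1} → Good Ho H u a m1 (R \ Us) (ζ \ Us) → Good Ho H u a m R ζ) ∨
        ∀ R ζ, S1 ⊆ R → ζ ⊆ R → Apart H S1 (R \ S1) → ζ ∩ S1 ⊆ {z1} →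
          R.card + u + 2 ≤ m + Ho.sz a → Good Ho H u a m R ζ) := by
  have hau := Ho.left_end_le hu hl
  have hal := hl.1
  have ha := Ho.sz_pos a (by omega)
  have hN := Ho.sz_le u hu
  have hcard : (Ho.Lv (Ho.L u + 1) (a + 1) m).card = (m - u - 1) + (a + Ho.sz a - (a + 1)) := by
    rw [Ho.Lv_two hu hl (by omega) (by omega) (by omega) hm, card_union_of_disjoint,
      Nat.card_Ioo, Nat.card_Ico]
    rw [disjoint_left]
    intro x hx hx'
    rw [mem_Ioo] at hx
    rw [mem_Ico] at hx'
    omega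
  obtain ⟨Us, hUs, f, m', hm1, hm2, hf, hout, hz, hstar⟩ := hS u le_rfl hu a p m S1 z1 (Or.inr hl)
    hp1 hp2 hp3 hm hp4 hz1 hc1 (by omega)
  have hq : ∀ v ∈ Us, m' ≤ f v ∧ f v < m := fun v hv => ((Ho.mem_Lv).1 (hf.mem hv)).1
  have hlev : ∀ R, Apart H S1 (R \ S1) → ∀ v ∈ Us, ∀ w ∈ R \ Us, H.Adj v w →
      Ho.L (f v) = Ho.L u + 1 := by
    intro R hR v hv w hw hvw
    rw [mem_sdiff] at hw
    by_cases hwS : w ∈ S1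
    · exact hout v hv w (mem_sdiff.2 ⟨hwS, hw.2⟩) hvw
    · exact absurd hvw (hR v (hUs hv) w (mem_sdiff.2 ⟨hw.1, hwS⟩)).2
  have hζ : ∀ ζ : Finset V, ζ ∩ S1 ⊆ {z1} → ∀ v ∈ ζ, v ∈ Us → Ho.G.Adj (f v) a := by
    intro ζ h v hv hvU
    have : v = z1 := mem_singleton.1 (h (mem_inter.2 ⟨hv, hUs hvU⟩))
    subst this
    have := hq v hvU
    exact Ho.near a u (f v) hu hl (by omega) (by omega) (hz hvU)
  refine ⟨Us, hUs, m', by omega, hstar, ?_⟩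
  by_cases hcase : u < m'
  · left
    rw [Ho.Lv_child hu hcase hm] at hf
    have hcU := hf.card_eq
    rw [Nat.card_Ico] at hcU
    refine ⟨hcase, by omega, ?_⟩
    rintro R ζ hSR hζR hap hζS ⟨g, m1, h1, h2, hg, hga⟩
    obtain ⟨k, hk, hk1, hk2⟩ := hf.union hg disjoint_sdiff (by
        rw [disjoint_left]
        intro x hx hx'
        simp only [mem_Ico, mem_union, mem_Ioo] at hx hx'
        omega) (by
        intro v hv w hw hvw
        have h3 := mem_Ico.1 (hf.mem hv)
        have h4 := hg.mem hw
        simp only [mem_Ico, mem_union, mem_Ioo] at h4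
        refine Ho.dom u a _ _ hu (Or.inr hl) (by omega) (by omega) (hlev R hap v hv w hw hvw)
          (by omega) (by omega) ?_ (by omega)
        rcases h4 with h4 | h4
        · exact Ho.lt_level u _ hu (by omega) (by omega)
        · rw [← hl.2.1]
          exact Ho.lt_level a _ (by omega) (by omega) (by omega))
    refine ⟨k, m1, h1, h2, hk.congr_sets (union_sdiff_of_subset (hUs.trans hSR)) ?_, ?_⟩
    · ext x
      simp only [mem_union, mem_Ico, mem_Ioo]
      omega
    · intro v hv
      by_cases hvU : v ∈ Us
      · rw [hk1 v hvU]
        exact hζ ζ hζS v hv hvU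
      · rw [hk2 v (mem_sdiff.2 ⟨hζR hv, hvU⟩)]
        exact hga v (mem_sdiff.2 ⟨hv, hvU⟩)
  · right
    intro R ζ hSR hζR hap hζS hRc
    have hLv : Ho.Lv (Ho.L u + 1) m' m = Ioo u m ∪ Ico (min m' (a + Ho.sz a)) (a + Ho.sz a) := by
      rw [Ho.Lv_two hu hl (by omega) (by omega) (by omega) hm]
      congr 1
      ext x
      simp only [mem_Ico]
      omega
    rw [hLv] at hf
    set m'' := min m' (a + Ho.sz a)
    have hm'' : m'' ≤ a + Ho.sz a := min_le_right _ _
    have hm3 : m'' ≤ m' := min_le_left _ _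
    have hm4 : a < m'' := lt_min hm1 (by omega)
    have hcU := Good.card_eq hu hl hf
    have hcS := card_sdiff_add_card_eq_card (hUs.trans hSR)
    obtain ⟨g, hg⟩ := fill_one hS (U := a) (by rw [hl.2.1]) (by omega) (m := m'') hm''
      (S := R \ Us) (by omega)
    have hgm : ∀ w ∈ R \ Us, a < g w ∧ g w < m'' := by
      intro w hw
      have := mem_Ico.1 (hg.mem hw)
      omega
    obtain ⟨k, hk, hk1, hk2⟩ := hf.union hg disjoint_sdiff (by
        rw [disjoint_left]
        intro x hx hx'
        simp only [mem_Ico, mem_union, mem_Ioo] at hx hx'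
        omega) (by
        intro v hv w hw hvw
        have h3 := hq v hv
        have h4 := hgm w hw
        refine Ho.dom u a _ _ hu (Or.inr hl) (by omega) (by omega) (hlev R hap v hv w hw hvw)
          (by omega) (by omega) ?_ (by omega)
        rw [← hl.2.1]
        exact Ho.lt_level a _ (by omega) (by omega) (by omega))
    refine ⟨k, m'' - (R \ Us).card, by omega, by omega,
      hk.congr_sets (union_sdiff_of_subset (hUs.trans hSR)) ?_, ?_⟩
    · ext x
      simp only [mem_union, mem_Ico, mem_Ioo]
      omega
    · intro v hv
      by_cases hvU : v ∈ Us
      · rw [hk1 v hvU]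
        exact hζ ζ hζS v hv hvU
      · have hv' := mem_sdiff.2 ⟨hζR hv, hvU⟩
        rw [hk2 v hv']
        have := hgm v hv'
        exact (Ho.desc a _ (by omega) this.1 (by omega)).symm

/-- The window `(u, m)` is empty. -/
lemma good_base (hS : ∀ U, Ho.L u ≤ Ho.L U → StepAt Ho H U) (hu : u < N) (hl : IsLeft Ho.L a u)
    {R ζ : Finset V} (hζ : ζ ⊆ R) (hR : R.card + 1 ≤ Ho.sz a) : Good Ho H u a (u + 1) R ζ := by
  have hal := hl.1
  obtain ⟨g, hg⟩ := fill_one hS (U := a) (by rw [hl.2.1]) (by omega) le_rfl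
      (S := R) (by omega)
  refine ⟨g, a + Ho.sz a - R.card, by omega, by omega, hg.congr_sets rfl ?_, ?_⟩
  · ext x
    simp only [mem_union, mem_Ico, mem_Ioo]
    omega
  · intro v hv
    have := mem_Ico.1 (hg.mem (hζ hv))
    exact (Ho.desc a _ (by omega) (by omega) (by omega)).symm

end Filling

set_option linter.unusedSectionVars false

section Parts

open Finset

variable {V : Type*} [DecidableEq V] {N : ℕ} {Ho : Host N} {H : SimpleGraph V}

lemma exists_subset_sum_between {ι : Type*} [DecidableEq ι] (w : ι → ℕ) (I : Finset ι)
    {c lo q : ℕ} (hq : ∀ i ∈ I, w i ≤ q) (hlo : c < lo) (h : lo ≤ c + ∑ i ∈ I, w i) :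
    ∃ J ⊆ I, lo ≤ c + ∑ i ∈ J, w i ∧ c + ∑ i ∈ J, w i + 1 ≤ lo + q := by
  induction I using Finset.induction_on with
  | empty =>
    simp at h
    omega
  | insert i I hi ih =>
    by_cases h' : lo ≤ c + ∑ j ∈ I, w j
    · obtain ⟨J, hJ, h1⟩ := ih (fun j hj => hq j (mem_insert_of_mem hj)) h'
      exact ⟨J, hJ.trans (subset_insert _ _), h1⟩
    · refine ⟨insert i I, Subset.rfl, h, ?_⟩
      rw [sum_insert hi]
      have := hq i (mem_insert_self _ _)
      omega

/-- The sets `Pc c` for `c ∈ I` are pairwise separated. -/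
def Pieces (H : SimpleGraph V) (I : Finset V) (Pc : V → Finset V) : Prop :=
  ∀ c ∈ I, ∀ d ∈ I, c ≠ d → Apart H (Pc c) (Pc d)

lemma Pieces.mono {I J : Finset V} {Pc : V → Finset V} (h : Pieces H I Pc) (hJ : J ⊆ I) :
    Pieces H J Pc := fun c hc d hd => h c (hJ hc) d (hJ hd)

lemma Pieces.card_biUnion {I : Finset V} {Pc : V → Finset V} (h : Pieces H I Pc) :
    (I.biUnion Pc).card = ∑ c ∈ I, (Pc c).card :=
  Finset.card_biUnion fun c hc d hd hcd => (h c hc d hd hcd).disjoint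

lemma Pieces.apart_biUnion {I J : Finset V} {Pc : V → Finset V} (h : Pieces H I Pc) {c : V}
    (hc : c ∈ I) (hJ : J ⊆ I) (hcJ : c ∉ J) : Apart H (Pc c) (J.biUnion Pc) :=
  Apart.biUnion_right fun d hd => h c hc d (hJ hd) (fun e => hcJ (e ▸ hd))

lemma Pieces.biUnion_apart {I J J' : Finset V} {Pc : V → Finset V} (h : Pieces H I Pc)
    (hJ : J ⊆ I) (hJ' : J' ⊆ I) (hd : Disjoint J J') :
    Apart H (J.biUnion Pc) (J'.biUnion Pc) :=
  (Apart.biUnion_right fun _ hc =>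
    (h.apart_biUnion (hJ hc) hJ' (disjoint_left.1 hd hc)).symm).symm

lemma Conn.card_le {I : Finset V} {Pc : V → Finset V} {S X : Finset V} {n : ℕ}
    (hI : Pieces H I Pc) (hS : ∀ c ∈ I, Apart H S (Pc c)) (hX : X ⊆ S ∪ I.biUnion Pc)
    (hc : Conn H X) (h1 : S.card < n) (h2 : ∀ c ∈ I, (Pc c).card < n) : X.card < n := by
  have hSI : Apart H S (I.biUnion Pc) := Apart.biUnion_right hS
  rcases hc S (by
    refine hSI.mono inter_subset_right ?_
    intro v hv
    rw [mem_sdiff] at hv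
    exact (mem_union.1 (hX hv.1)).resolve_left hv.2) with h | h
  · exact (card_le_card h).trans_lt h1
  rcases X.eq_empty_or_nonempty with rfl | ⟨v, hv⟩
  · rw [card_empty]
    omega
  have hv' := (mem_union.1 (hX hv)).resolve_left (disjoint_left.1 h hv)
  obtain ⟨c, hcI, hvc⟩ := mem_biUnion.1 hv'
  rcases hc (Pc c) (by
    refine ((hS c hcI).symm.union_right (hI.apart_biUnion hcI (erase_subset c I)
      (notMem_erase c I))).mono inter_subset_right ?_
    intro w hw
    rw [mem_sdiff] at hw
    rcases mem_union.1 (hX hw.1) with h1 | h1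
    · exact mem_union_left _ h1
    · obtain ⟨d, hd, hwd⟩ := mem_biUnion.1 h1
      refine mem_union_right _ (mem_biUnion.2 ⟨d, mem_erase.2 ⟨?_, hd⟩, hwd⟩)
      rintro rfl
      exact hw.2 hwd) with h | h
  · exact (card_le_card h).trans_lt (h2 c hcI)
  · exact absurd hvc (disjoint_left.1 h hv)

variable {a u : ℕ}

lemma Good.congr {m : ℕ} {R ζ R' ζ' : Finset V} (h : Good Ho H u a m R ζ) (hR : R = R')
    (hζ : ζ = ζ') : Good Ho H u a m R' ζ' := hR ▸ hζ ▸ h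

lemma peel_part (hS : ∀ U, Ho.L u ≤ Ho.L U → StepAt Ho H U) (hu : u < N)
    (hl : IsLeft Ho.L a u) {p m : ℕ} (hp1 : u < p) (hp2 : p < m) (hp3 : m ≤ p + Ho.sz p)
    (hp4 : Ho.L p = Ho.L u + 1) (hm : m ≤ u + Ho.sz u) {S1 ζ1 : Finset V} (hζ1 : ζ1 ⊆ S1)
    (hζc : ζ1.card ≤ 1) (hc1 : m ≤ p + S1.card) (hc2 : S1.card + u + 2 ≤ m + Ho.sz a) :
    ∃ Us ⊆ S1, ∃ m1 < m, ((∀ X ⊆ S1, Conn H X → X.card < m - p) → ζ1 ⊆ Us) ∧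
      ((u < m1 ∧ Us.card + m1 = m ∧ ∀ Q ζ', Apart H S1 Q → ζ' ⊆ Q →
          Good Ho H u a m1 ((S1 \ Us) ∪ Q) ((ζ1 \ Us) ∪ ζ') →
          Good Ho H u a m (S1 ∪ Q) (ζ1 ∪ ζ')) ∨
        ∀ Q ζ', Apart H S1 Q → ζ' ⊆ Q → S1.card + Q.card + u + 2 ≤ m + Ho.sz a →
          Good Ho H u a m (S1 ∪ Q) (ζ1 ∪ ζ')) := by
  obtain ⟨z1, hz1, hz⟩ : ∃ z1 ∈ S1, ζ1 ⊆ {z1} := by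
    rcases ζ1.eq_empty_or_nonempty with rfl | ⟨x, hx⟩
    · obtain ⟨x, hx⟩ : S1.Nonempty := card_pos.1 (by omega)
      exact ⟨x, hx, by simp⟩
    · exact ⟨x, hζ1 hx, fun y hy => mem_singleton.2 (card_le_one.1 hζc y hy x hx)⟩
  have hQ1 : ∀ Q, Apart H S1 Q → Apart H S1 ((S1 ∪ Q) \ S1) := fun Q hQ =>
    hQ.mono Subset.rfl (by
      intro v hv
      rw [mem_sdiff, mem_union] at hv
      exact hv.1.resolve_left hv.2)
  have hQ2 : ∀ Q ζ', Apart H S1 Q → ζ' ⊆ Q → (ζ1 ∪ ζ') ∩ S1 ⊆ {z1} := by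
    intro Q ζ' hQ hζ' v hv
    rw [mem_inter, mem_union] at hv
    rcases hv.1 with h | h
    · exact hz h
    · exact absurd (hζ' h) (disjoint_left.1 hQ.disjoint hv.2)
  obtain ⟨Us, hUs, m1, hm1, hstar, h⟩ := peel hS hu hl hp1 hp2 hp3 hp4 hm hz1 hc1 hc2
  refine ⟨Us, hUs, m1, hm1, ?_, ?_⟩
  · intro h v hv
    rw [mem_singleton.1 (hz hv)]
    exact hstar fun X hX hc => by
      have := h X hX hc
      omega
  · have hdis : ∀ Q : Finset V, Apart H S1 Q → Q \ Us = Q := fun Q hQ =>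
      sdiff_eq_self_of_disjoint ((hQ.mono hUs Subset.rfl).symm.disjoint)
    rcases h with ⟨h1, h2, h3⟩ | h
    · refine Or.inl ⟨h1, h2, fun Q ζ' hQ hζ' hg => ?_⟩
      refine h3 _ _ subset_union_left (union_subset_union hζ1 hζ') (hQ1 Q hQ) (hQ2 Q ζ' hQ hζ')
        (hg.congr ?_ ?_)
      · rw [union_sdiff_distrib, hdis Q hQ]
      · rw [union_sdiff_distrib, hdis ζ' (hQ.mono Subset.rfl hζ')]
    · refine Or.inr fun Q ζ' hQ hζ' hc => ?_
      refine h _ _ subset_union_left (union_subset_union hζ1 hζ') (hQ1 Q hQ) (hQ2 Q ζ' hQ hζ') ?_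
      rwa [card_union_of_disjoint hQ.disjoint]

lemma sum_erase_card {I : Finset V} {Pc : V → Finset V} {c : V} (hc : c ∈ I) :
    ∑ d ∈ I, (Pc d).card = (Pc c).card + ∑ d ∈ I.erase c, (Pc d).card :=
  (add_sum_erase I (fun d => (Pc d).card) hc).symm

lemma good_one (hS : ∀ U, Ho.L u ≤ Ho.L U → StepAt Ho H U) (hu : u < N)
    (hl : IsLeft Ho.L a u) (Pc : V → Finset V) {m : ℕ} {I S ζ : Finset V} (hum : u < m)
    (hmu : m ≤ u + Ho.sz u) (hI : Pieces H I Pc) (hSI : ∀ c ∈ I, Apart H S (Pc c))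
    (hζ : ζ ⊆ S) (hζc : ζ.card ≤ 1) (hle : S.card + u + 2 ≤ m + Ho.sz a)
    (hge : m ≤ S.card + ∑ c ∈ I, (Pc c).card + u + 1) (hpc : ∀ c ∈ I, (Pc c).card ≤ Ho.sz a) :
    ∃ J ⊆ I, Good Ho H u a m (S ∪ J.biUnion Pc) ζ := by
  induction hn : m + I.card using Nat.strong_induction_on generalizing m I S ζ with
  | _ n ih =>
    by_cases hm1 : m = u + 1
    · subst hm1
      exact ⟨∅, empty_subset _,
        (good_base hS hu hl hζ (by omega)).congr (by simp) rfl⟩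
    obtain ⟨p, hp1, hp2, hp3, hp4⟩ := Ho.exists_child hu (by omega) hmu
    by_cases hc : m ≤ p + S.card
    · obtain ⟨Us, hUs, m1, hm1, -, ⟨h1, h2, h3⟩ | h⟩ :=
        peel_part hS hu hl hp1 hp2 hp3 hp4 hmu hζ hζc hc hle
      · have hcS := card_sdiff_add_card_eq_card hUs
        obtain ⟨J, hJ, hg⟩ := ih (m1 + I.card) (by omega) h1 (by omega) hI
          (fun c hc => (hSI c hc).mono sdiff_subset Subset.rfl)
          (sdiff_subset_sdiff hζ Subset.rfl) ((card_le_card sdiff_subset).trans hζc)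
          (show (S \ Us).card + u + 2 ≤ m1 + Ho.sz a by omega)
          (by omega) hpc rfl
        refine ⟨J, hJ, (h3 (J.biUnion Pc) ∅ (Apart.biUnion_right fun c hc => hSI c (hJ hc))
          (empty_subset _) (hg.congr rfl ?_)).congr rfl ?_⟩ <;> simp
      · refine ⟨∅, empty_subset _, (h ∅ ∅ ?_ (empty_subset _) (by simpa using hle)).congr ?_ ?_⟩
        · intro v _ w hw
          simp at hw
        · simp
        · simp
    · obtain ⟨c0, hc0, hpos⟩ : ∃ c ∈ I, 0 < (Pc c).card := by
        by_contra hcon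
        push Not at hcon
        have : ∑ c ∈ I, (Pc c).card = 0 :=
          sum_eq_zero fun c hc => by
            have := hcon c hc
            omega
        omega
      have hcu : (S ∪ Pc c0).card = S.card + (Pc c0).card :=
        card_union_of_disjoint (hSI c0 hc0).disjoint
      have hsum := sum_erase_card (Pc := Pc) hc0
      have hcI := card_erase_add_one hc0
      have := hpc c0 hc0
      obtain ⟨J, hJ, hg⟩ := ih (m + (I.erase c0).card) (by omega) hum hmu
        (hI.mono (erase_subset _ _))
        (fun c hc => (hSI c (mem_of_mem_erase hc)).union_left
          (hI c0 hc0 c (mem_of_mem_erase hc) (ne_of_mem_erase hc).symm))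
        (hζ.trans subset_union_left) hζc (by omega) (by omega)
        (fun c hc => hpc c (mem_of_mem_erase hc)) rfl
      refine ⟨insert c0 J, insert_subset hc0 (hJ.trans (erase_subset _ _)), hg.congr ?_ rfl⟩
      rw [biUnion_insert, union_assoc]

/-- Two distinguished parts together with small pieces. -/
structure TwoParts (Ho : Host N) (H : SimpleGraph V) (u a : ℕ) (Pc : V → Finset V) (q m : ℕ)
    (I S1 ζ1 S2 ζ2 : Finset V) : Prop where
  um : u < m
  mu : m ≤ u + Ho.sz u
  pieces : Pieces H I Pc
  s1 : ∀ c ∈ I, Apart H S1 (Pc c)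
  s2 : ∀ c ∈ I, Apart H S2 (Pc c)
  s12 : Apart H S1 S2
  z1 : ζ1 ⊆ S1
  z2 : ζ2 ⊆ S2
  z1c : ζ1.card ≤ 1
  z2c : ζ2.card ≤ 1
  le : S1.card + S2.card + u + 2 ≤ m + Ho.sz a
  ge : m + Ho.sz a ≤ S1.card + S2.card + ∑ c ∈ I, (Pc c).card + u + 2
  piece_le : ∀ c ∈ I, (Pc c).card ≤ q
  two_q : 2 * q ≤ Ho.sz a
  inv : S1.card + S2.card + 2 * q + u + 1 ≤ m + Ho.sz a ∨ S1.card + q ≤ Ho.sz a ∨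
    S2.card + q ≤ Ho.sz a

lemma TwoParts.swap {Pc : V → Finset V} {q m : ℕ} {I S1 ζ1 S2 ζ2 : Finset V}
    (h : TwoParts Ho H u a Pc q m I S1 ζ1 S2 ζ2) : TwoParts Ho H u a Pc q m I S2 ζ2 S1 ζ1 where
  um := h.um
  mu := h.mu
  pieces := h.pieces
  s1 := h.s2
  s2 := h.s1
  s12 := h.s12.symm
  z1 := h.z2
  z2 := h.z1
  z1c := h.z2c
  z2c := h.z1c
  le := by
    have := h.le
    omega
  ge := by
    have := h.ge
    omega
  piece_le := h.piece_le
  two_q := h.two_q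
  inv := by
    have := h.inv
    omega

set_option maxHeartbeats 4000000 in
lemma good_two_step (hS : ∀ U, Ho.L u ≤ Ho.L U → StepAt Ho H U) (hu : u < N)
    (hl : IsLeft Ho.L a u) {Pc : V → Finset V} {q m : ℕ} {I S1 ζ1 S2 ζ2 : Finset V}
    (ih : ∀ m' I' S1' ζ1' S2' ζ2', m' + I'.card < m + I.card →
      TwoParts Ho H u a Pc q m' I' S1' ζ1' S2' ζ2' →
      ∃ J ⊆ I', Good Ho H u a m' (S1' ∪ (S2' ∪ J.biUnion Pc)) (ζ1' ∪ ζ2'))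
    (h : TwoParts Ho H u a Pc q m I S1 ζ1 S2 ζ2) (hc21 : S2.card ≤ S1.card) :
    ∃ J ⊆ I, Good Ho H u a m (S1 ∪ (S2 ∪ J.biUnion Pc)) (ζ1 ∪ ζ2) := by
  have hum := h.um
  have hmu := h.mu
  have hle := h.le
  have hge := h.ge
  have htq := h.two_q
  have hinv := h.inv
  have hzz := union_subset_union h.z1 h.z2
  by_cases hm1 : m = u + 1
  · subst hm1
    refine ⟨∅, empty_subset _, (good_base hS hu hl hzz ?_).congr (by simp) rfl⟩
    rw [card_union_of_disjoint h.s12.disjoint]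
    omega
  obtain ⟨p, hp1, hp2, hp3, hp4⟩ := Ho.exists_child hu (by omega) hmu
  have hN := Ho.sz_le u hu
  have hT3 := Ho.sz_mono a u p hu hl (by omega) (by rw [hl.2.1]; omega)
  by_cases hc : m ≤ p + S1.card
  · obtain ⟨Us, hUs, m1, hm1, -, ⟨h1, h2, h3⟩ | h'⟩ :=
      peel_part hS hu hl hp1 hp2 hp3 hp4 hmu h.z1 h.z1c hc (by omega)
    · have hcS := card_sdiff_add_card_eq_card hUs
      obtain ⟨J, hJ, hg⟩ := ih m1 I (S1 \ Us) (ζ1 \ Us) S2 ζ2 (by omega)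
        { um := h1, mu := by omega, pieces := h.pieces
          s1 := fun c hc => (h.s1 c hc).mono sdiff_subset Subset.rfl
          s2 := h.s2
          s12 := h.s12.mono sdiff_subset Subset.rfl
          z1 := sdiff_subset_sdiff h.z1 Subset.rfl
          z2 := h.z2
          z1c := (card_le_card sdiff_subset).trans h.z1c
          z2c := h.z2c
          le := by omega
          ge := by omega
          piece_le := h.piece_le
          two_q := htq
          inv := by omega }
      exact ⟨J, hJ, h3 _ _ (h.s12.union_right (Apart.biUnion_right fun c hc => h.s1 c (hJ hc)))
        (h.z2.trans subset_union_left) hg⟩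
    · exact ⟨∅, empty_subset _, (h' S2 ζ2 h.s12 h.z2 (by omega)).congr (by simp) rfl⟩
  by_cases hbig : ∃ c ∈ I, m ≤ p + (Pc c).card
  · obtain ⟨c0, hc0, hb⟩ := hbig
    have hcu : (S1 ∪ Pc c0).card = S1.card + (Pc c0).card :=
      card_union_of_disjoint (h.s1 c0 hc0).disjoint
    have hsum := sum_erase_card (Pc := Pc) hc0
    have hcI := card_erase_add_one hc0
    have := h.piece_le c0 hc0
    obtain ⟨J, hJ, hg⟩ := ih m (I.erase c0) (S1 ∪ Pc c0) ζ1 S2 ζ2 (by omega)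
      { um := hum, mu := hmu, pieces := h.pieces.mono (erase_subset _ _)
        s1 := fun c hc => (h.s1 c (mem_of_mem_erase hc)).union_left
          (h.pieces c0 hc0 c (mem_of_mem_erase hc) (ne_of_mem_erase hc).symm)
        s2 := fun c hc => h.s2 c (mem_of_mem_erase hc)
        s12 := h.s12.union_left (h.s2 c0 hc0).symm
        z1 := h.z1.trans subset_union_left
        z2 := h.z2
        z1c := h.z1c
        z2c := h.z2c
        le := by omega
        ge := by omega
        piece_le := fun c hc => h.piece_le c (mem_of_mem_erase hc)
        two_q := htq
        inv := by omega }
    refine ⟨insert c0 J, insert_subset hc0 (hJ.trans (erase_subset _ _)), hg.congr ?_ rfl⟩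
    ext v
    simp only [biUnion_insert, mem_union]
    tauto
  push Not at hbig
  obtain ⟨J0, hJ0, hb1, hb2⟩ := exists_subset_sum_between (fun c => (Pc c).card) I
    (c := S1.card) (lo := m - p) (q := q) h.piece_le (by omega) (by omega)
  have hs0 : Apart H S1 (J0.biUnion Pc) := Apart.biUnion_right fun c hc => h.s1 c (hJ0 hc)
  have hs2 : Apart H S2 (J0.biUnion Pc) := Apart.biUnion_right fun c hc => h.s2 c (hJ0 hc)
  have hcu : (S1 ∪ J0.biUnion Pc).card = S1.card + ∑ c ∈ J0, (Pc c).card := by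
    rw [card_union_of_disjoint hs0.disjoint, (h.pieces.mono hJ0).card_biUnion]
  have hsum : ∑ c ∈ I \ J0, (Pc c).card + ∑ c ∈ J0, (Pc c).card = ∑ c ∈ I, (Pc c).card :=
    sum_sdiff hJ0
  have h02 : Apart H (S1 ∪ J0.biUnion Pc) S2 := h.s12.union_left hs2.symm
  obtain ⟨Us, hUs, m1, hm1, hstar, hh⟩ :=
      peel_part hS hu hl hp1 hp2 hp3 hp4 hmu (h.z1.trans subset_union_left) h.z1c
        (S1 := S1 ∪ J0.biUnion Pc) (by omega) (by omega)
  have hz1U : ζ1 \ Us = ∅ := sdiff_eq_empty_iff_subset.2 (hstar fun X hX hc =>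
    hc.card_le (h.pieces.mono hJ0) (fun c hc => h.s1 c (hJ0 hc)) hX (by omega)
      fun c hc => by
        have := hbig c (hJ0 hc)
        omega)
  rcases hh with ⟨h1, h2, h3⟩ | h'
  · have hcS := card_sdiff_add_card_eq_card hUs
    have hcu2 : (((S1 ∪ J0.biUnion Pc) \ Us) ∪ S2).card =
        ((S1 ∪ J0.biUnion Pc) \ Us).card + S2.card :=
      card_union_of_disjoint (h02.mono sdiff_subset Subset.rfl).disjoint
    have hap : ∀ c ∈ I \ J0, Apart H (S1 ∪ J0.biUnion Pc) (Pc c) := fun c hc =>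
      (h.s1 c (mem_sdiff.1 hc).1).union_left
        (h.pieces.apart_biUnion (mem_sdiff.1 hc).1 hJ0 (mem_sdiff.1 hc).2).symm
    obtain ⟨J, hJ, hg⟩ := good_one hS hu hl Pc (m := m1) (I := I \ J0)
      (S := ((S1 ∪ J0.biUnion Pc) \ Us) ∪ S2) (ζ := ζ2) h1 (by omega)
      (h.pieces.mono sdiff_subset)
      (fun c hc => ((hap c hc).mono sdiff_subset Subset.rfl).union_left
        (h.s2 c (mem_sdiff.1 hc).1))
      (h.z2.trans subset_union_right) h.z2c (by omega) (by omega)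
      (fun c hc => by
        have := h.piece_le c (mem_sdiff.1 hc).1
        omega)
    refine ⟨J0 ∪ J, union_subset hJ0 (hJ.trans sdiff_subset),
      (h3 (S2 ∪ J.biUnion Pc) ζ2 (h02.union_right (Apart.biUnion_right fun c hc => hap c (hJ hc)))
        (h.z2.trans subset_union_left) (hg.congr ?_ ?_)).congr ?_ rfl⟩
    · rw [union_assoc]
    · rw [hz1U, empty_union]
    · ext v
      simp only [union_biUnion, mem_union]
      tauto
  · refine ⟨J0, hJ0, (h' S2 ζ2 h02 h.z2 (by omega)).congr ?_ rfl⟩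
    ext v
    simp only [mem_union]
    tauto

lemma good_two (hS : ∀ U, Ho.L u ≤ Ho.L U → StepAt Ho H U) (hu : u < N)
    (hl : IsLeft Ho.L a u) {Pc : V → Finset V} {q m : ℕ} {I S1 ζ1 S2 ζ2 : Finset V}
    (h : TwoParts Ho H u a Pc q m I S1 ζ1 S2 ζ2) :
    ∃ J ⊆ I, Good Ho H u a m (S1 ∪ (S2 ∪ J.biUnion Pc)) (ζ1 ∪ ζ2) := by
  induction hn : m + I.card using Nat.strong_induction_on
    generalizing m I S1 ζ1 S2 ζ2 with
  | _ n ih =>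
    have ih' : ∀ m' I' S1' ζ1' S2' ζ2', m' + I'.card < m + I.card →
      TwoParts Ho H u a Pc q m' I' S1' ζ1' S2' ζ2' →
      ∃ J ⊆ I', Good Ho H u a m' (S1' ∪ (S2' ∪ J.biUnion Pc)) (ζ1' ∪ ζ2') :=
      fun m' I' S1' ζ1' S2' ζ2' hlt h' => ih _ (by omega) h' rfl
    rcases le_total S2.card S1.card with hc | hc
    · exact good_two_step hS hu hl ih' h hc
    · obtain ⟨J, hJ, hg⟩ := good_two_step hS hu hl ih' h.swap hc
      exact ⟨J, hJ, hg.congr (union_left_comm _ _ _) (union_comm _ _)⟩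

end Parts

section ThreeParts

open Finset

variable {V : Type*} [DecidableEq V] {N : ℕ} {Ho : Host N} {H : SimpleGraph V} {a u : ℕ}

/-- Three distinguished parts together with small pieces. -/
structure ThreeParts (Ho : Host N) (H : SimpleGraph V) (u a : ℕ) (Pc : V → Finset V) (q m : ℕ)
    (I S1 ζ1 S2 ζ2 S3 ζ3 : Finset V) : Prop where
  um : u < m
  mu : m ≤ u + Ho.sz u
  pieces : Pieces H I Pc
  s1 : ∀ c ∈ I, Apart H S1 (Pc c)
  s2 : ∀ c ∈ I, Apart H S2 (Pc c)
  s3 : ∀ c ∈ I, Apart H S3 (Pc c)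
  s12 : Apart H S1 S2
  s13 : Apart H S1 S3
  s23 : Apart H S2 S3
  z1 : ζ1 ⊆ S1
  z2 : ζ2 ⊆ S2
  z3 : ζ3 ⊆ S3
  z1c : ζ1.card ≤ 1
  z2c : ζ2.card ≤ 1
  z3c : ζ3.card ≤ 1
  le : S1.card + S2.card + S3.card + u + 2 ≤ m + Ho.sz a
  ge : m + Ho.sz a ≤ S1.card + S2.card + S3.card + ∑ c ∈ I, (Pc c).card + u + 2
  piece_le : ∀ c ∈ I, (Pc c).card ≤ q
  seven_q : 7 * q + 5 ≤ Ho.sz a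
  inv : S1.card + S2.card + S3.card + u + 2 ≤ m ∨ (S1.card ≤ q ∧ S2.card ≤ q) ∨
    (S1.card ≤ q ∧ S3.card ≤ q) ∨ (S2.card ≤ q ∧ S3.card ≤ q)

lemma ThreeParts.swap12 {Pc : V → Finset V} {q m : ℕ} {I S1 ζ1 S2 ζ2 S3 ζ3 : Finset V}
    (h : ThreeParts Ho H u a Pc q m I S1 ζ1 S2 ζ2 S3 ζ3) :
    ThreeParts Ho H u a Pc q m I S2 ζ2 S1 ζ1 S3 ζ3 where
  um := h.um
  mu := h.mu
  pieces := h.pieces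
  s1 := h.s2
  s2 := h.s1
  s3 := h.s3
  s12 := h.s12.symm
  s13 := h.s23
  s23 := h.s13
  z1 := h.z2
  z2 := h.z1
  z3 := h.z3
  z1c := h.z2c
  z2c := h.z1c
  z3c := h.z3c
  le := by
    have := h.le
    omega
  ge := by
    have := h.ge
    omega
  piece_le := h.piece_le
  seven_q := h.seven_q
  inv := by
    have := h.inv
    omega

lemma ThreeParts.swap13 {Pc : V → Finset V} {q m : ℕ} {I S1 ζ1 S2 ζ2 S3 ζ3 : Finset V}
    (h : ThreeParts Ho H u a Pc q m I S1 ζ1 S2 ζ2 S3 ζ3) :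
    ThreeParts Ho H u a Pc q m I S3 ζ3 S2 ζ2 S1 ζ1 where
  um := h.um
  mu := h.mu
  pieces := h.pieces
  s1 := h.s3
  s2 := h.s2
  s3 := h.s1
  s12 := h.s23.symm
  s13 := h.s13.symm
  s23 := h.s12.symm
  z1 := h.z3
  z2 := h.z2
  z3 := h.z1
  z1c := h.z3c
  z2c := h.z2c
  z3c := h.z1c
  le := by
    have := h.le
    omega
  ge := by
    have := h.ge
    omega
  piece_le := h.piece_le
  seven_q := h.seven_q
  inv := by
    have := h.inv
    omega

set_option maxHeartbeats 4000000 in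
lemma good_three_step (hS : ∀ U, Ho.L u ≤ Ho.L U → StepAt Ho H U) (hu : u < N)
    (hl : IsLeft Ho.L a u) {Pc : V → Finset V} {q m : ℕ} {I S1 ζ1 S2 ζ2 S3 ζ3 : Finset V}
    (ih : ∀ m' I' S1' ζ1' S2' ζ2' S3' ζ3', m' + I'.card < m + I.card →
      ThreeParts Ho H u a Pc q m' I' S1' ζ1' S2' ζ2' S3' ζ3' →
      ∃ J ⊆ I', Good Ho H u a m' (S1' ∪ (S2' ∪ (S3' ∪ J.biUnion Pc))) (ζ1' ∪ (ζ2' ∪ ζ3')))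
    (h : ThreeParts Ho H u a Pc q m I S1 ζ1 S2 ζ2 S3 ζ3) (hc21 : S2.card ≤ S1.card)
    (hc31 : S3.card ≤ S1.card) :
    ∃ J ⊆ I, Good Ho H u a m (S1 ∪ (S2 ∪ (S3 ∪ J.biUnion Pc))) (ζ1 ∪ (ζ2 ∪ ζ3)) := by
  have hum := h.um
  have hmu := h.mu
  have hle := h.le
  have hge := h.ge
  have hsq := h.seven_q
  have hinv := h.inv
  have hz23 := union_subset_union h.z2 h.z3
  have hzz := union_subset_union h.z1 hz23
  have h1_23 := h.s12.union_right h.s13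
  have hc23 := card_union_of_disjoint h.s23.disjoint
  by_cases hm1 : m = u + 1
  · subst hm1
    refine ⟨∅, empty_subset _, (good_base hS hu hl hzz ?_).congr (by simp) rfl⟩
    rw [card_union_of_disjoint h1_23.disjoint]
    omega
  obtain ⟨p, hp1, hp2, hp3, hp4⟩ := Ho.exists_child hu (by omega) hmu
  have hN := Ho.sz_le u hu
  have hT3 := Ho.sz_mono a u p hu hl (by omega) (by rw [hl.2.1]; omega)
  by_cases hc : m ≤ p + S1.card
  · obtain ⟨Us, hUs, m1, hm1, -, ⟨h1, h2, h3⟩ | h'⟩ :=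
      peel_part hS hu hl hp1 hp2 hp3 hp4 hmu h.z1 h.z1c hc (by omega)
    · have hcS := card_sdiff_add_card_eq_card hUs
      obtain ⟨J, hJ, hg⟩ := ih m1 I (S1 \ Us) (ζ1 \ Us) S2 ζ2 S3 ζ3 (by omega)
        { um := h1, mu := by omega, pieces := h.pieces
          s1 := fun c hc => (h.s1 c hc).mono sdiff_subset Subset.rfl
          s2 := h.s2
          s3 := h.s3
          s12 := h.s12.mono sdiff_subset Subset.rfl
          s13 := h.s13.mono sdiff_subset Subset.rfl
          s23 := h.s23
          z1 := sdiff_subset_sdiff h.z1 Subset.rfl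
          z2 := h.z2
          z3 := h.z3
          z1c := (card_le_card sdiff_subset).trans h.z1c
          z2c := h.z2c
          z3c := h.z3c
          le := by omega
          ge := by omega
          piece_le := h.piece_le
          seven_q := hsq
          inv := by omega }
      refine ⟨J, hJ, h3 _ _ (h.s12.union_right (h.s13.union_right
        (Apart.biUnion_right fun c hc => h.s1 c (hJ hc)))) ?_ hg⟩
      exact union_subset_union h.z2 (h.z3.trans subset_union_left)
    · exact ⟨∅, empty_subset _, (h' (S2 ∪ S3) (ζ2 ∪ ζ3) h1_23 hz23 (by omega)).congr
        (by simp) rfl⟩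
  by_cases hbig : ∃ c ∈ I, m ≤ p + (Pc c).card
  · obtain ⟨c0, hc0, hb⟩ := hbig
    have hcu : (S1 ∪ Pc c0).card = S1.card + (Pc c0).card :=
      card_union_of_disjoint (h.s1 c0 hc0).disjoint
    have hsum := sum_erase_card (Pc := Pc) hc0
    have hcI := card_erase_add_one hc0
    have := h.piece_le c0 hc0
    obtain ⟨J, hJ, hg⟩ := ih m (I.erase c0) (S1 ∪ Pc c0) ζ1 S2 ζ2 S3 ζ3 (by omega)
      { um := hum, mu := hmu, pieces := h.pieces.mono (erase_subset _ _)
        s1 := fun c hc => (h.s1 c (mem_of_mem_erase hc)).union_left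
          (h.pieces c0 hc0 c (mem_of_mem_erase hc) (ne_of_mem_erase hc).symm)
        s2 := fun c hc => h.s2 c (mem_of_mem_erase hc)
        s3 := fun c hc => h.s3 c (mem_of_mem_erase hc)
        s12 := h.s12.union_left (h.s2 c0 hc0).symm
        s13 := h.s13.union_left (h.s3 c0 hc0).symm
        s23 := h.s23
        z1 := h.z1.trans subset_union_left
        z2 := h.z2
        z3 := h.z3
        z1c := h.z1c
        z2c := h.z2c
        z3c := h.z3c
        le := by omega
        ge := by omega
        piece_le := fun c hc => h.piece_le c (mem_of_mem_erase hc)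
        seven_q := hsq
        inv := by omega }
    refine ⟨insert c0 J, insert_subset hc0 (hJ.trans (erase_subset _ _)), hg.congr ?_ rfl⟩
    ext v
    simp only [biUnion_insert, mem_union]
    tauto
  push Not at hbig
  obtain ⟨J0, hJ0, hb1, hb2⟩ := exists_subset_sum_between (fun c => (Pc c).card) I
    (c := S1.card) (lo := m - p) (q := q) h.piece_le (by omega) (by omega)
  have hs0 : Apart H S1 (J0.biUnion Pc) := Apart.biUnion_right fun c hc => h.s1 c (hJ0 hc)
  have hs2 : Apart H S2 (J0.biUnion Pc) := Apart.biUnion_right fun c hc => h.s2 c (hJ0 hc)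
  have hs3 : Apart H S3 (J0.biUnion Pc) := Apart.biUnion_right fun c hc => h.s3 c (hJ0 hc)
  have hcu : (S1 ∪ J0.biUnion Pc).card = S1.card + ∑ c ∈ J0, (Pc c).card := by
    rw [card_union_of_disjoint hs0.disjoint, (h.pieces.mono hJ0).card_biUnion]
  have hsum : ∑ c ∈ I \ J0, (Pc c).card + ∑ c ∈ J0, (Pc c).card = ∑ c ∈ I, (Pc c).card :=
    sum_sdiff hJ0
  have h02 : Apart H (S1 ∪ J0.biUnion Pc) S2 := h.s12.union_left hs2.symm
  have h03 : Apart H (S1 ∪ J0.biUnion Pc) S3 := h.s13.union_left hs3.symm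
  obtain ⟨Us, hUs, m1, hm1, hstar, hh⟩ :=
      peel_part hS hu hl hp1 hp2 hp3 hp4 hmu (h.z1.trans subset_union_left) h.z1c
        (S1 := S1 ∪ J0.biUnion Pc) (by omega) (by omega)
  have hz1U : ζ1 \ Us = ∅ := sdiff_eq_empty_iff_subset.2 (hstar fun X hX hc =>
    hc.card_le (h.pieces.mono hJ0) (fun c hc => h.s1 c (hJ0 hc)) hX (by omega)
      fun c hc => by
        have := hbig c (hJ0 hc)
        omega)
  rcases hh with ⟨h1, h2, h3⟩ | h'
  · have hcS := card_sdiff_add_card_eq_card hUs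
    have hcu2 : (((S1 ∪ J0.biUnion Pc) \ Us) ∪ S2).card =
        ((S1 ∪ J0.biUnion Pc) \ Us).card + S2.card :=
      card_union_of_disjoint (h02.mono sdiff_subset Subset.rfl).disjoint
    have hap : ∀ c ∈ I \ J0, Apart H (S1 ∪ J0.biUnion Pc) (Pc c) := fun c hc =>
      (h.s1 c (mem_sdiff.1 hc).1).union_left
        (h.pieces.apart_biUnion (mem_sdiff.1 hc).1 hJ0 (mem_sdiff.1 hc).2).symm
    obtain ⟨J, hJ, hg⟩ := good_two hS hu hl (m := m1) (I := I \ J0) (Pc := Pc) (q := q)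
      (S1 := ((S1 ∪ J0.biUnion Pc) \ Us) ∪ S2) (ζ1 := ζ2) (S2 := S3) (ζ2 := ζ3)
      { um := h1, mu := by omega, pieces := h.pieces.mono sdiff_subset
        s1 := fun c hc => ((hap c hc).mono sdiff_subset Subset.rfl).union_left
          (h.s2 c (mem_sdiff.1 hc).1)
        s2 := fun c hc => h.s3 c (mem_sdiff.1 hc).1
        s12 := (h03.mono sdiff_subset Subset.rfl).union_left h.s23
        z1 := h.z2.trans subset_union_right
        z2 := h.z3
        z1c := h.z2c
        z2c := h.z3c
        le := by omega
        ge := by omega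
        piece_le := fun c hc => h.piece_le c (mem_sdiff.1 hc).1
        two_q := by omega
        inv := by omega }
    refine ⟨J0 ∪ J, union_subset hJ0 (hJ.trans sdiff_subset),
      (h3 (S2 ∪ (S3 ∪ J.biUnion Pc)) (ζ2 ∪ ζ3) (h02.union_right (h03.union_right
        (Apart.biUnion_right fun c hc => hap c (hJ hc))))
        (union_subset_union h.z2 (h.z3.trans subset_union_left)) (hg.congr ?_ ?_)).congr ?_ rfl⟩
    · rw [union_assoc]
    · rw [hz1U, empty_union]
    · ext v
      simp only [union_biUnion, mem_union]
      tauto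
  · refine ⟨J0, hJ0, (h' (S2 ∪ S3) (ζ2 ∪ ζ3) (h02.union_right h03) hz23 (by omega)).congr
      ?_ rfl⟩
    ext v
    simp only [mem_union]
    tauto

lemma good_three (hS : ∀ U, Ho.L u ≤ Ho.L U → StepAt Ho H U) (hu : u < N)
    (hl : IsLeft Ho.L a u) {Pc : V → Finset V} {q m : ℕ} {I S1 ζ1 S2 ζ2 S3 ζ3 : Finset V}
    (h : ThreeParts Ho H u a Pc q m I S1 ζ1 S2 ζ2 S3 ζ3) :
    ∃ J ⊆ I, Good Ho H u a m (S1 ∪ (S2 ∪ (S3 ∪ J.biUnion Pc))) (ζ1 ∪ (ζ2 ∪ ζ3)) := by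
  induction hn : m + I.card using Nat.strong_induction_on
    generalizing m I S1 ζ1 S2 ζ2 S3 ζ3 with
  | _ n ih =>
    have ih' : ∀ m' I' S1' ζ1' S2' ζ2' S3' ζ3', m' + I'.card < m + I.card →
      ThreeParts Ho H u a Pc q m' I' S1' ζ1' S2' ζ2' S3' ζ3' →
      ∃ J ⊆ I', Good Ho H u a m' (S1' ∪ (S2' ∪ (S3' ∪ J.biUnion Pc))) (ζ1' ∪ (ζ2' ∪ ζ3')) :=
      fun m' I' S1' ζ1' S2' ζ2' S3' ζ3' hlt h' => ih _ (by omega) h' rfl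
    by_cases hc1 : S2.card ≤ S1.card ∧ S3.card ≤ S1.card
    · exact good_three_step hS hu hl ih' h hc1.1 hc1.2
    by_cases hc2 : S1.card ≤ S2.card ∧ S3.card ≤ S2.card
    · obtain ⟨J, hJ, hg⟩ := good_three_step hS hu hl ih' h.swap12 hc2.1 hc2.2
      exact ⟨J, hJ, hg.congr (union_left_comm _ _ _) (union_left_comm _ _ _)⟩
    · obtain ⟨J, hJ, hg⟩ := good_three_step hS hu hl ih' h.swap13 (by omega) (by omega)
      refine ⟨J, hJ, hg.congr ?_ ?_⟩
      · ext v
        simp only [mem_union]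
        tauto
      · ext v
        simp only [mem_union]
        tauto

end ThreeParts

section Heads

open Finset

variable {V : Type*} [DecidableEq V] {N : ℕ} {Ho : Host N} {H : SimpleGraph V}

namespace Host

lemma Lv_closed_two {a u x m : ℕ} (hu : u < N) (h : IsLeft Ho.L a u) (hx : a ≤ x) (hxu : x ≤ u)
    (hum : u < m) (hm : m ≤ u + Ho.sz u) :
    Ho.Lv (Ho.L u) x m = Ico u m ∪ Ico x (a + Ho.sz a) := by
  have hau := Ho.left_end_le hu h
  ext w
  simp only [mem_Lv, mem_union, mem_Ico]
  constructor
  · rintro ⟨⟨h1, h2⟩, h3⟩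
    by_cases hw : w < a + Ho.sz a
    · exact Or.inr ⟨h1, hw⟩
    · left
      refine ⟨?_, h2⟩
      by_contra hc
      have := Ho.level_lt_of_gap hu h w (by omega) (by omega)
      omega
  · rintro (⟨h1, h2⟩ | ⟨h1, h2⟩)
    · exact ⟨⟨by omega, h2⟩, Ho.le_level hu h1 (by omega)⟩
    · refine ⟨⟨h1, by omega⟩, ?_⟩
      rw [← h.2.1]
      exact Ho.le_level (by omega) (by omega) h2

lemma Lv_closed_three {b a u x m : ℕ} (hu : u < N) (h : IsLeft Ho.L a u) (h' : IsLeft Ho.L b a)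
    (hx : b ≤ x) (hxa : x ≤ a) (hum : u < m) (hm : m ≤ u + Ho.sz u) :
    Ho.Lv (Ho.L u) x m = Ico u m ∪ Ico a (a + Ho.sz a) ∪ Ico x (b + Ho.sz b) := by
  have hau := Ho.left_end_le hu h
  have hal := h.1
  have haN : a < N := by omega
  have hba := Ho.left_end_le haN h'
  have hs := Ho.sz_pos a haN
  have h1 := Ho.Lv_closed_two hu h le_rfl hal.le hum hm
  have h2 := Ho.Lv_closed_two haN h' hx hxa (m := a + 1) (by omega) (by omega)
  rw [h.2.1] at h2
  ext w
  have h3 := congrArg (w ∈ ·) h1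
  have h4 := congrArg (w ∈ ·) h2
  simp only [mem_Lv, mem_union, mem_Ico, eq_iff_iff] at h3 h4 ⊢
  by_cases hw : w < a
  · have e1 : ¬ a ≤ w := by omega
    have e2 : ¬ u ≤ w := by omega
    have e3 : w < m := by omega
    have e4 : w < a + 1 := by omega
    simp only [e1, e2, e3, e4, false_and, false_or, and_true] at h4 ⊢
    exact h4
  · have e1 : ¬ w < b + Ho.sz b := by omega
    have e2 : a ≤ w := by omega
    have e3 : x ≤ w := by omega
    simp only [e1, e2, e3, and_false, or_false, true_and] at h3 ⊢
    exact h3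

lemma exists_left_of_card {U lo u m : ℕ} (hu : u < N) (hlo : lo = U ∨ IsLeft Ho.L lo U)
    (hL : Ho.L u = Ho.L U + 1)
    (hc : m - u < (Ho.Lv (Ho.L U + 1) (lo + 1) m).card) : ∃ a, IsLeft Ho.L a u ∧ lo < a := by
  have hLlo : Ho.L lo = Ho.L U := by
    rcases hlo with rfl | h
    · rfl
    · exact h.2.1
  have hns : ¬ Ho.Lv (Ho.L U + 1) (lo + 1) m ⊆ Ico u m := by
    intro h
    have := card_le_card h
    rw [Nat.card_Ico] at this
    omega
  obtain ⟨w, hw, hw'⟩ := not_subset.1 hns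
  rw [mem_Lv] at hw
  rw [mem_Ico] at hw'
  exact Ho.exists_left hu hLlo hL (w := w) (by omega) (by omega) hw.2

lemma exists_left_left_of_card {U lo a u m : ℕ} (hu : u < N) (hlo : lo = U ∨ IsLeft Ho.L lo U)
    (hL : Ho.L u = Ho.L U + 1) (h : IsLeft Ho.L a u)
    (hc : m - u + Ho.sz a < (Ho.Lv (Ho.L U + 1) (lo + 1) m).card) :
    ∃ b, IsLeft Ho.L b a ∧ lo < b := by
  have hLlo : Ho.L lo = Ho.L U := by
    rcases hlo with rfl | h
    · rfl
    · exact h.2.1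
  have hns : ¬ Ho.Lv (Ho.L U + 1) (lo + 1) m ⊆ Ico u m ∪ Ico a (a + Ho.sz a) := by
    intro h
    have := (card_le_card h).trans (card_union_le _ _)
    rw [Nat.card_Ico, Nat.card_Ico] at this
    omega
  obtain ⟨w, hw, hw'⟩ := not_subset.1 hns
  rw [mem_Lv] at hw
  simp only [mem_union, mem_Ico] at hw'
  have hal := h.1
  have hwa : w < a := by
    by_contra hwa
    have := Ho.level_lt_of_gap hu h w (by omega) (by omega)
    omega
  exact Ho.exists_left (by omega) hLlo (by rw [h.2.1, hL]) (w := w) (by omega) (by omega) hw.2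

end Host

/-- `Us` fills the top of the window `(lo, m)` of indices of level greater than `L U`. -/
def Fills (Ho : Host N) (H : SimpleGraph V) (U lo u m : ℕ) (S : Finset V) (z : V)
    (Us : Finset V) : Prop :=
  ∃ f m', lo < m' ∧ m' ≤ u ∧ Emb H Ho.G f Us (Ho.Lv (Ho.L U + 1) m' m) ∧
    (∀ v ∈ Us, ∀ w ∈ S \ Us, H.Adj v w → Ho.L (f v) = Ho.L U + 1) ∧
    (z ∈ Us → Ho.L (f z) = Ho.L U + 1)

/-- A window `(lo, m)` inside the descendants of `U`, whose last index is below the child `u`. -/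
structure Window (Ho : Host N) (U lo u m : ℕ) : Prop where
  hU : U < N
  hlo : lo = U ∨ IsLeft Ho.L lo U
  hUu : U < u
  hum : u < m
  hmu : m ≤ u + Ho.sz u
  hmU : m ≤ U + Ho.sz U
  hL : Ho.L u = Ho.L U + 1

variable {U lo u m a : ℕ}

lemma Window.lo_lt (h : Window Ho U lo u m) : lo < u := by
  have := h.hUu
  rcases h.hlo with rfl | h
  · exact this
  · exact h.1.trans this

lemma Window.lt (h : Window Ho U lo u m) : u < N := by
  have := Ho.sz_le U h.hU
  have := h.hum
  have := h.hmU
  omega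

lemma fills_one_head (h : Window Ho U lo u m) {S R : Finset V} {z x0 : V}
    (hx0 : x0 ∉ R) (hR : ∀ v ∈ R, ∀ w ∈ S, H.Adj v w → w ∈ R ∨ w = x0)
    (hz : z ∉ R) {f : V → ℕ} {P : Finset ℕ} {m' : ℕ} (hf : Emb H Ho.G f R P) (hlo : lo < m')
    (hm' : m' ≤ u) (hP : insert u P = Ho.Lv (Ho.L U + 1) m' m) (huP : u ∉ P) :
    Fills Ho H U lo u m S z (insert x0 R) := by
  have hum := h.hum
  have hmu := h.hmu
  have hmU := h.hmU
  obtain ⟨k, hk, hk1, hk2⟩ := (Emb.singleton (H := H) (G := Ho.G) x0 u).union hf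
    (disjoint_singleton_left.2 hx0) (disjoint_singleton_left.2 huP) (by
      intro v _ w hw _
      have h1 := hf.mem hw
      have h2 : f w ∈ Ho.Lv (Ho.L U + 1) m' m := hP ▸ mem_insert_of_mem h1
      rw [Ho.mem_Lv] at h2
      exact Ho.dom U lo u _ h.hU h.hlo h.lo_lt (by omega) h.hL (by omega) (by omega) h2.2
        (fun e => huP (e ▸ h1)))
  refine ⟨k, m', hlo, hm', hk.congr_sets rfl hP, ?_, ?_⟩
  · intro v hv w hw hvw
    rw [mem_sdiff, mem_insert, not_or] at hw
    rcases mem_insert.1 hv with rfl | hv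
    · rw [hk1 v (mem_singleton_self v), h.hL]
    · rcases hR v hv w hw.1 hvw with h1 | h1
      · exact absurd h1 hw.2.2
      · exact absurd h1 hw.2.1
  · intro hzU
    rcases mem_insert.1 hzU with rfl | hzU
    · rw [hk1 z (mem_singleton_self z), h.hL]
    · exact absurd hzU hz

lemma fills_two_heads (h : Window Ho U lo u m) (hl : IsLeft Ho.L a u)
    {S R : Finset V} {z xu xa : V} (hxx : xu ≠ xa) (hxu : xu ∉ R) (hxa : xa ∉ R)
    (hR : ∀ v ∈ R, ∀ w ∈ S, H.Adj v w → w ∈ R ∨ w = xu ∨ w = xa)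
    (hz : z ∉ R) {f : V → ℕ} {P : Finset ℕ} {m' : ℕ} (hf : Emb H Ho.G f R P) (hlo : lo < m')
    (hm' : m' ≤ u) (hP : insert u (insert a P) = Ho.Lv (Ho.L U + 1) m' m) (huP : u ∉ P)
    (haP : a ∉ P) (hRa : ∀ v ∈ R, H.Adj v xa → Ho.G.Adj (f v) a) :
    Fills Ho H U lo u m S z (insert xu (insert xa R)) := by
  have hum := h.hum
  have hmu := h.hmu
  have hmU := h.hmU
  have hau := hl.1
  obtain ⟨g, hg, hg1, hg2⟩ := (Emb.singleton (H := H) (G := Ho.G) xa a).union hf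
    (disjoint_singleton_left.2 hxa) (disjoint_singleton_left.2 haP) (by
      intro v hv w hw hvw
      rw [mem_singleton.1 hv] at hvw
      exact (hRa w hw hvw.symm).symm)
  have hmem : ∀ w ∈ {xa} ∪ R, g w ∈ insert a P := fun w hw => hg.mem hw
  obtain ⟨k, hk, hk1, hk2⟩ := (Emb.singleton (H := H) (G := Ho.G) xu u).union hg
    (disjoint_singleton_left.2 (by simp [hxx, hxu]))
    (disjoint_singleton_left.2 (by simp [hau.ne', huP])) (by
      intro v _ w hw _
      have h1 := hmem w hw
      have h2 : g w ∈ Ho.Lv (Ho.L U + 1) m' m := hP ▸ mem_insert_of_mem h1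
      rw [Ho.mem_Lv] at h2
      refine Ho.dom U lo u _ h.hU h.hlo h.lo_lt (by omega) h.hL (by omega) (by omega) h2.2
        (fun e => ?_)
      rw [e, mem_insert] at h1
      rcases h1 with h1 | h1
      · omega
      · exact huP h1)
  have hkxa : k xa = a := by
    rw [hk2 xa (by simp), hg1 xa (by simp)]
  have hkxu : k xu = u := hk1 xu (by simp)
  have hLa : Ho.L a = Ho.L U + 1 := by rw [hl.2.1, h.hL]
  refine ⟨k, m', hlo, hm', hk.congr_sets rfl hP, ?_, ?_⟩
  · intro v hv w hw hvw
    simp only [mem_sdiff, mem_insert, not_or] at hw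
    simp only [mem_insert] at hv
    rcases hv with rfl | rfl | hv
    · rw [hkxu, h.hL]
    · rw [hkxa, hLa]
    · rcases hR v hv w hw.1 hvw with h1 | h1 | h1
      · exact absurd h1 hw.2.2.2
      · exact absurd h1 hw.2.1
      · exact absurd h1 hw.2.2.1
  · intro hzU
    simp only [mem_insert] at hzU
    rcases hzU with rfl | rfl | hzU
    · rw [hkxu, h.hL]
    · rw [hkxa, hLa]
    · exact absurd hzU hz

/-- Place `R` below `u` and `a`, the rest of `Tot` below `a` and its left neighbour, and the
vertices `xu`, `xa` on `u`, `a`. -/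
lemma fills_of_good (hS : ∀ U', Ho.L u ≤ Ho.L U' → StepAt Ho H U') (h : Window Ho U lo u m)
    (hl : IsLeft Ho.L a u) (hloa : lo < a)
    {S Tot R ζ : Finset V} {z xu xa : V}
    (hcard : S.card ≤ (Ho.Lv (Ho.L U + 1) (lo + 1) m).card)
    (hTS : Tot ⊆ S) (hxuS : xu ∈ S) (hxaS : xa ∈ S) (hxx : xu ≠ xa)
    (hxu : xu ∉ Tot) (hxa : xa ∉ Tot)
    (hT : ∀ v ∈ Tot, ∀ w ∈ S, H.Adj v w → w ∈ Tot ∨ w = xu ∨ w = xa)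
    (hz : z ∉ Tot) (hRT : R ⊆ Tot) (hap : Apart H R (Tot \ R)) (hg : Good Ho H u a m R ζ)
    (hζ : ∀ v ∈ R, H.Adj v xa → v ∈ ζ) (hge : m + Ho.sz a ≤ Tot.card + u + 2)
    (hle : Tot.card + 2 * u + 3 ≤ 2 * m) :
    Fills Ho H U lo u m S z (insert xu (insert xa Tot)) := by
  have hum := h.hum
  have hmu := h.hmu
  have hu := h.lt
  have hal := hl.1
  have hau := Ho.left_end_le hu hl
  have haN : a < N := by omega
  have hsa := Ho.sz_pos a haN
  have hSa : ∀ U', Ho.L a ≤ Ho.L U' → StepAt Ho H U' := by rwa [hl.2.1]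
  have hTc : Tot.card + 2 ≤ S.card := by
    have : (insert xu (insert xa Tot)).card = Tot.card + 2 := by
      rw [card_insert_of_notMem, card_insert_of_notMem hxa]
      simp [hxx, hxu]
    rw [← this]
    exact card_le_card (insert_subset hxuS (insert_subset hxaS hTS))
  obtain ⟨f, m1, hm1, hm1', hf, hfa⟩ := hg
  have hRc := Good.card_eq hu hl hf
  have hWc := card_sdiff_add_card_eq_card hRT
  obtain ⟨g, P, m', hgP, hm', hm'a, hPlow, hPhigh⟩ : ∃ g P m', Emb H Ho.G g (Tot \ R) P ∧
      lo < m' ∧ m' ≤ a ∧ (∀ x ∈ P, lo < x ∧ x < m1 ∧ x ≠ a ∧ Ho.L U + 1 ≤ Ho.L x) ∧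
      insert u (insert a ((Ioo u m ∪ Ico m1 (a + Ho.sz a)) ∪ P)) =
        Ho.Lv (Ho.L U + 1) m' m := by
    by_cases hWeq : (Tot \ R).card + a + 1 = m1
    · obtain ⟨g, hg⟩ := fill_one hSa le_rfl haN (m := m1) hm1' (S := Tot \ R) (by omega)
      refine ⟨g, _, a, hg, hloa, le_rfl, ?_, ?_⟩
      · intro x hx
        rw [mem_Ico] at hx
        refine ⟨by omega, by omega, by omega, ?_⟩
        rw [← h.hL, ← hl.2.1]
        exact (Ho.lt_level a x haN (by omega) (by omega)).le
      · rw [← h.hL, Ho.Lv_closed_two hu hl le_rfl (by omega) hum hmu]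
        ext x
        simp only [mem_insert, mem_union, mem_Ioo, mem_Ico]
        omega
    · obtain ⟨b, hb, hlob⟩ := Ho.exists_left_left_of_card (m := m) hu h.hlo h.hL hl (by omega)
      have hT1 := Ho.sz_le_add a b u hu hl hb
      have hbl := hb.1
      have hba := Ho.left_end_le haN hb
      obtain ⟨J, hJ, g, m2, hm2, hm2', hg, -⟩ := good_one hSa haN hb (fun _ => ∅) (m := m1)
        (I := ∅) (S := Tot \ R) (ζ := ∅) hm1 hm1' (by intro c hc; simp at hc)
        (by simp) (by simp) (by simp) (by omega) (by simp; omega) (by simp)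
      rw [subset_empty.1 hJ, biUnion_empty, union_empty] at hg
      refine ⟨g, _, m2, hg, by omega, by omega, ?_, ?_⟩
      · intro x hx
        simp only [mem_union, mem_Ioo, mem_Ico] at hx
        refine ⟨by omega, by omega, by omega, ?_⟩
        rw [← h.hL, ← hl.2.1]
        rcases hx with hx | hx
        · exact (Ho.lt_level a x haN (by omega) (by omega)).le
        · rw [← hb.2.1]
          exact (Ho.lt_level b x (by omega) (by omega) (by omega)).le
      · rw [← h.hL, Ho.Lv_closed_three hu hl hb (by omega) (by omega) hum hmu]
        ext x
        simp only [mem_insert, mem_union, mem_Ioo, mem_Ico]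
        omega
  obtain ⟨k, hk, hk1, hk2⟩ := hf.union hgP disjoint_sdiff (by
      rw [disjoint_left]
      intro x hx hx'
      have := hPlow x hx'
      simp only [mem_union, mem_Ioo, mem_Ico] at hx
      omega) (fun v hv w hw hvw => absurd hvw (hap v hv w hw).2)
  rw [union_sdiff_of_subset hRT] at hk
  refine fills_two_heads h hl hxx hxu hxa hT hz hk hm' (by omega) hPhigh ?_ ?_ ?_
  · intro hx
    rcases mem_union.1 hx with hx | hx
    · simp only [mem_union, mem_Ioo, mem_Ico] at hx
      omega
    · have := hPlow u hx
      omega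
  · intro hx
    rcases mem_union.1 hx with hx | hx
    · simp only [mem_union, mem_Ioo, mem_Ico] at hx
      omega
    · exact (hPlow a hx).2.2.1 rfl
  · intro v hv hva
    by_cases hvR : v ∈ R
    · rw [hk1 v hvR]
      exact hfa v (hζ v hvR hva)
    · have hv' := mem_sdiff.2 ⟨hv, hvR⟩
      rw [hk2 v hv']
      have h1 := hPlow _ (hgP.mem hv')
      have hmU := h.hmU
      refine (Ho.dom U lo a _ h.hU h.hlo hloa (by omega) (by rw [hl.2.1, h.hL]) h1.1
        (by omega) h1.2.2.2 h1.2.2.1).symm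

end Heads

section Step

open Finset

variable {V : Type*} [DecidableEq V] {N : ℕ} {Ho : Host N} {H : SimpleGraph V}
  {S : Finset V} {z : V} {par : V → V} {rk : V → ℕ}

namespace Rooted

variable {x c v w : V} {J : Finset V}

lemma card_lt_of_kid (h : Rooted H S z par rk) (hx : x ∈ S) (hc : c ∈ kids S z par x) :
    (below S par c).card < (below S par x).card :=
  card_lt_card ⟨below_trans (kid_mem_below hx hc),
    fun hs => h.not_mem_below_kid hc (hs (self_mem_below hx))⟩

lemma pieces (h : Rooted H S z par rk) (hJ : J ⊆ kids S z par x) :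
    Pieces H J (below S par) :=
  fun _ hc _ hd hcd => h.kids_sep (hJ hc) (hJ hd) hcd

lemma edge_kids (h : Rooted H S z par rk) (hJ : J ⊆ kids S z par x)
    (hv : v ∈ J.biUnion (below S par)) (hw : w ∈ S) (ha : H.Adj v w) :
    w ∈ J.biUnion (below S par) ∨ w = x := by
  obtain ⟨c, hc, hv⟩ := mem_biUnion.1 hv
  by_cases hwc : w ∈ below S par c
  · exact Or.inl (mem_biUnion.2 ⟨c, hc, hwc⟩)
  · exact Or.inr ((h.edge_out hv hw hwc ha).2.trans (mem_kids.1 (hJ hc)).2.2)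

lemma biUnion_subset (J : Finset V) : J.biUnion (below S par) ⊆ S :=
  Finset.biUnion_subset.2 fun c _ => below_subset c

lemma root_not_mem_kids (h : Rooted H S z par rk) (hJ : J ⊆ kids S z par x) :
    z ∉ J.biUnion (below S par) := by
  intro hz
  obtain ⟨c, hc, hz⟩ := mem_biUnion.1 hz
  exact h.root_not_mem (mem_kids.1 (hJ hc)).2.1 hz

lemma self_not_mem_kids (h : Rooted H S z par rk) (hJ : J ⊆ kids S z par x) :
    x ∉ J.biUnion (below S par) := by
  intro hx
  obtain ⟨c, hc, hx⟩ := mem_biUnion.1 hx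
  exact h.not_mem_below_kid (hJ hc) hx

lemma mem_of_adj_parent (h : Rooted H S z par rk) (hx : x ∈ S) (hJ : J ⊆ kids S z par x)
    (hv : v ∈ J.biUnion (below S par)) (ha : H.Adj v x) : v ∈ J := by
  obtain ⟨c, hc, hv⟩ := mem_biUnion.1 hv
  exact (h.edge_out hv hx (h.not_mem_below_kid (hJ hc)) ha).1 ▸ hc

lemma par_not_mem_below (h : Rooted H S z par rk) (hx : x ∈ S) (hxz : x ≠ z) :
    par x ∉ below S par x := by
  intro hp
  have := h.rk_le hp
  have := h.rk_lt x hx hxz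
  omega

end Rooted

open Rooted

/-- Some filling part contains `x`. -/
def FillsWith (Ho : Host N) (H : SimpleGraph V) (U lo u m : ℕ) (S : Finset V) (z x : V) : Prop :=
  ∃ Us ⊆ S, x ∈ Us ∧ Fills Ho H U lo u m S z Us

/-- A window together with a rooted vertex set to be placed in it. -/
structure Stage (Ho : Host N) (H : SimpleGraph V) (U lo u m : ℕ) (S : Finset V) (z : V)
    (par : V → V) (rk : V → ℕ) : Prop extends Window Ho U lo u m where
  hS : ∀ U', Ho.L u ≤ Ho.L U' → StepAt Ho H U'
  hcard : S.card ≤ (Ho.Lv (Ho.L U + 1) (lo + 1) m).card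
  tree : Rooted H S z par rk

variable {U lo u m a : ℕ}

lemma Stage.fills_eq (h : Stage Ho H U lo u m S z par rk) {x : V} {J : Finset V} (hx : x ∈ S)
    (hJ : J ⊆ kids S z par x) (hc : ∑ c ∈ J, (below S par c).card + u + 1 = m) :
    FillsWith Ho H U lo u m S z x := by
  have hum := h.hum
  have hmu := h.hmu
  have hJc := h.tree.card_biUnion_kids hJ
  obtain ⟨f, hf⟩ := fill_one h.hS le_rfl h.lt hmu (S := J.biUnion (below S par)) (by omega)
  refine ⟨_, insert_subset hx (Rooted.biUnion_subset J), mem_insert_self _ _,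
    fills_one_head h.toWindow (h.tree.self_not_mem_kids hJ)
      (fun v hv w hw ha => h.tree.edge_kids hJ hv hw ha) (h.tree.root_not_mem_kids hJ) hf
      h.lo_lt le_rfl ?_ ?_⟩
  · ext w
    simp only [mem_insert, mem_Ico, Host.mem_Lv]
    constructor
    · intro hw
      have hw' : u ≤ w ∧ w < m := by omega
      refine ⟨hw', ?_⟩
      have := Ho.le_level h.lt hw'.1 (by omega)
      have := h.hL
      omega
    · omega
  · simp only [mem_Ico]
    omega

lemma Stage.exists_left (h : Stage Ho H U lo u m S z par rk) (hS : m < u + S.card) :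
    ∃ a, IsLeft Ho.L a u ∧ lo < a := by
  have := h.hcard
  have := h.hum
  exact Ho.exists_left_of_card (m := m) h.lt h.hlo h.hL (by omega)

lemma Stage.fills_le (h : Stage Ho H U lo u m S z par rk) (hl : IsLeft Ho.L a u) (hlo : lo < a)
    {x : V} {J : Finset V} (hx : x ∈ S) (hJ : J ⊆ kids S z par x)
    (hc : m ≤ ∑ c ∈ J, (below S par c).card + u + 1)
    (hc' : ∑ c ∈ J, (below S par c).card + u + 2 ≤ m + Ho.sz a) :
    FillsWith Ho H U lo u m S z x := by
  have hum := h.hum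
  have hmu := h.hmu
  have hJc := h.tree.card_biUnion_kids hJ
  have hal := hl.1
  have hau := Ho.left_end_le h.lt hl
  obtain ⟨K, hK, f, m1, hm1, hm1', hf, -⟩ := good_one h.hS h.lt hl (fun _ => ∅) (m := m)
    (I := ∅) (S := J.biUnion (below S par)) (ζ := ∅) hum hmu (by intro c hc; simp at hc)
    (by simp) (by simp) (by simp) (by omega) (by simp; omega) (by simp)
  rw [subset_empty.1 hK, biUnion_empty, union_empty] at hf
  refine ⟨_, insert_subset hx (Rooted.biUnion_subset J), mem_insert_self _ _,
    fills_one_head h.toWindow (h.tree.self_not_mem_kids hJ)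
      (fun v hv w hw ha => h.tree.edge_kids hJ hv hw ha) (h.tree.root_not_mem_kids hJ) hf
      (m' := m1) (by omega) (by omega) ?_ ?_⟩
  · rw [← h.hL, Ho.Lv_closed_two h.lt hl (by omega) (by omega) hum hmu]
    ext w
    simp only [mem_insert, mem_Ico, mem_union, mem_Ioo]
    omega
  · simp only [mem_Ico, mem_union, mem_Ioo]
    omega

/-- A set `E` of children of `x`, another child `b` of `x`, and `y` below `b`. -/
structure Branch (S : Finset V) (z : V) (par : V → V) (x b : V) (E : Finset V) (y : V) :
    Prop where
  hx : x ∈ S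
  hE : E ⊆ kids S z par x
  hb : b ∈ kids S z par x
  hbE : b ∉ E
  hy : y ∈ below S par b

namespace Branch

variable {x b y : V} {E : Finset V}

lemma y_mem (h : Branch S z par x b E y) : y ∈ S := below_subset _ h.hy

lemma insert_subset (h : Branch S z par x b E y) : insert b E ⊆ kids S z par x :=
  Finset.insert_subset h.hb h.hE

lemma ne (h : Branch S z par x b E y) (hR : Rooted H S z par rk) : y ≠ x := by
  rintro rfl
  exact hR.not_mem_below_kid h.hb h.hy

lemma ne_root (h : Branch S z par x b E y) (hR : Rooted H S z par rk) : y ≠ z := by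
  rintro rfl
  exact hR.root_not_mem (mem_kids.1 h.hb).2.1 h.hy

lemma apart (h : Branch S z par x b E y) (hR : Rooted H S z par rk) :
    Apart H (E.biUnion (below S par)) (below S par b) :=
  ((hR.pieces h.insert_subset).apart_biUnion (mem_insert_self b E) (subset_insert b E)
    h.hbE).symm

lemma not_mem (h : Branch S z par x b E y) (hR : Rooted H S z par rk) :
    y ∉ E.biUnion (below S par) :=
  disjoint_right.1 (h.apart hR).disjoint h.hy

lemma card_erase (h : Branch S z par x b E y) (hR : Rooted H S z par rk) :
    (((insert b E).biUnion (below S par)).erase y).card + 1 =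
      ∑ c ∈ E, (below S par c).card + (below S par b).card := by
  rw [card_erase_add_one (mem_biUnion.2 ⟨b, mem_insert_self b E, h.hy⟩),
    hR.card_biUnion_kids h.insert_subset, sum_insert h.hbE, add_comm]

lemma edge_erase (h : Branch S z par x b E y) (hR : Rooted H S z par rk) {v w : V}
    (hv : v ∈ ((insert b E).biUnion (below S par)).erase y) (hw : w ∈ S) (ha : H.Adj v w) :
    w ∈ ((insert b E).biUnion (below S par)).erase y ∨ w = x ∨ w = y := by
  rw [mem_erase]
  rcases hR.edge_kids h.insert_subset (mem_of_mem_erase hv) hw ha with h1 | h1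
  · by_cases hwy : w = y
    · exact Or.inr (Or.inr hwy)
    · exact Or.inl ⟨hwy, h1⟩
  · exact Or.inr (Or.inl h1)

end Branch

/-- Use all of `E` and the branch of `b`, with `x` on `u` and `y` on `a`. -/
lemma Stage.fills_branch (h : Stage Ho H U lo u m S z par rk) (hl : IsLeft Ho.L a u)
    (hlo : lo < a) {x b y : V} {E R ζ : Finset V} (hB : Branch S z par x b E y)
    (hge : m + Ho.sz a ≤ ∑ c ∈ E, (below S par c).card + (below S par b).card + u + 1)
    (hle : ∑ c ∈ E, (below S par c).card + (below S par b).card + 2 * u + 2 ≤ 2 * m)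
    (hR : R ⊆ ((insert b E).biUnion (below S par)).erase y)
    (hap : Apart H R (((insert b E).biUnion (below S par)).erase y \ R))
    (hg : Good Ho H u a m R ζ) {xu xa : V} (hxx : xu = x ∧ xa = y ∨ xu = y ∧ xa = x)
    (hζ : ∀ v ∈ R, H.Adj v xa → v ∈ ζ) :
    FillsWith Ho H U lo u m S z x := by
  have hc := hB.card_erase h.tree
  have hyx := hB.ne h.tree
  have hx := h.tree.self_not_mem_kids hB.insert_subset
  have hTS : ((insert b E).biUnion (below S par)).erase y ⊆ S :=
    (erase_subset _ _).trans (Rooted.biUnion_subset _)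
  refine ⟨insert xu (insert xa (((insert b E).biUnion (below S par)).erase y)), ?_, ?_,
    fills_of_good h.hS h.toWindow hl hlo h.hcard hTS ?_ ?_ ?_ ?_ ?_ ?_ ?_ hR hap hg hζ
    (by omega) (by omega)⟩
  · refine Finset.insert_subset ?_ (Finset.insert_subset ?_ hTS)
    · rcases hxx with ⟨rfl, rfl⟩ | ⟨rfl, rfl⟩
      exacts [hB.hx, hB.y_mem]
    · rcases hxx with ⟨rfl, rfl⟩ | ⟨rfl, rfl⟩
      exacts [hB.y_mem, hB.hx]
  · rcases hxx with ⟨rfl, rfl⟩ | ⟨rfl, rfl⟩ <;> simp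
  · rcases hxx with ⟨rfl, rfl⟩ | ⟨rfl, rfl⟩
    exacts [hB.hx, hB.y_mem]
  · rcases hxx with ⟨rfl, rfl⟩ | ⟨rfl, rfl⟩
    exacts [hB.y_mem, hB.hx]
  · rcases hxx with ⟨rfl, rfl⟩ | ⟨rfl, rfl⟩
    exacts [hyx.symm, hyx]
  · rcases hxx with ⟨rfl, rfl⟩ | ⟨rfl, rfl⟩
    exacts [fun h' => hx (mem_of_mem_erase h'), notMem_erase _ _]
  · rcases hxx with ⟨rfl, rfl⟩ | ⟨rfl, rfl⟩
    exacts [notMem_erase _ _, fun h' => hx (mem_of_mem_erase h')]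
  · intro v hv w hw ha
    have := hB.edge_erase h.tree hv hw ha
    rcases hxx with ⟨rfl, rfl⟩ | ⟨rfl, rfl⟩ <;> tauto
  · exact fun h' => h.tree.root_not_mem_kids hB.insert_subset (mem_of_mem_erase h')

end Step

section StepCases

open Finset

variable {V : Type*} [DecidableEq V] {N : ℕ} {Ho : Host N} {H : SimpleGraph V}
  {S : Finset V} {z : V} {par : V → V} {rk : V → ℕ} {U lo u m a : ℕ}

open Rooted

lemma good_of_single (hS : ∀ U', Ho.L u ≤ Ho.L U' → StepAt Ho H U') (hu : u < N)
    (hl : IsLeft Ho.L a u) {R ζ : Finset V} (hum : u < m) (hmu : m ≤ u + Ho.sz u) (hζ : ζ ⊆ R)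
    (hζc : ζ.card ≤ 1) (hle : R.card + u + 2 ≤ m + Ho.sz a) (hge : m ≤ R.card + u + 1) :
    Good Ho H u a m R ζ := by
  obtain ⟨J, hJ, hg⟩ := good_one hS hu hl (fun _ => ∅) (m := m) (I := ∅) (S := R) (ζ := ζ)
    hum hmu (by intro c hc; simp at hc) (by simp) hζ hζc hle (by simpa using hge) (by simp)
  rwa [subset_empty.1 hJ, biUnion_empty, union_empty] at hg

namespace Branch

variable {x b y : V} {E : Finset V}

lemma par_mem (h : Branch S z par x b E y) (hR : Rooted H S z par rk) (hyb : y ≠ b) :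
    par y ∈ below S par b \ below S par y :=
  mem_sdiff.2 ⟨hR.par_mem_below h.hy hyb, hR.par_not_mem_below h.y_mem (h.ne_root hR)⟩

lemma subset_erase (h : Branch S z par x b E y) (hR : Rooted H S z par rk) {R w}
    (hRB : R ⊆ below S par b) (hw : w ∈ below S par b) (hwR : w ∉ R) :
    E.biUnion (below S par) ∪ R ⊆ ((insert b E).biUnion (below S par)).erase w := by
  intro v hv
  rw [biUnion_insert, mem_erase, mem_union]
  rcases mem_union.1 hv with hv | hv
  · exact ⟨((h.apart hR) v hv w hw).1, Or.inr hv⟩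
  · exact ⟨fun e => hwR (e ▸ hv), Or.inl (hRB hv)⟩

lemma erase_sdiff_subset {R : Finset V} {w : V} :
    ((insert b E).biUnion (below S par)).erase w \ (E.biUnion (below S par) ∪ R) ⊆
      (below S par b \ R).erase w := by
  intro v hv
  simp only [biUnion_insert, mem_sdiff, mem_erase, mem_union, not_or] at hv ⊢
  exact ⟨hv.1.1, hv.1.2.resolve_right hv.2.1, hv.2.2⟩

end Branch

/-- Put the branch without the part below `y` under `u`, with `y` on `a`. -/
lemma Stage.fills_above (h : Stage Ho H U lo u m S z par rk) (hl : IsLeft Ho.L a u)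
    (hlo : lo < a) {x b y : V} {E : Finset V} (hB : Branch S z par x b E y)
    (hge : m + Ho.sz a ≤ ∑ c ∈ E, (below S par c).card + (below S par b).card + u + 1)
    (hle : ∑ c ∈ E, (below S par c).card + (below S par b).card + 2 * u + 2 ≤ 2 * m)
    (hyb : y ≠ b)
    (h1 : m + (below S par y).card ≤
      ∑ c ∈ E, (below S par c).card + (below S par b).card + u + 1)
    (h2 : ∑ c ∈ E, (below S par c).card + (below S par b).card + u + 2 ≤
      m + Ho.sz a + (below S par y).card) :
    FillsWith Ho H U lo u m S z x := by
  have hR := h.tree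
  have hyB := below_trans hB.hy
  have hpar := hB.par_mem hR hyb
  have hself := self_mem_below (par := par) hB.y_mem
  have hc := card_sdiff_add_card_eq_card hyB
  have hcE := hR.card_biUnion_kids hB.hE
  have hcR := card_union_of_disjoint
    ((hB.apart hR).mono Subset.rfl (sdiff_subset (t := below S par y))).disjoint
  refine h.fills_branch hl hlo hB hge hle (hB.subset_erase hR sdiff_subset hB.hy (by simp [hself]))
    ?_ (good_of_single h.hS h.lt hl h.hum h.hmu (ζ := {par y})
      (singleton_subset_iff.2 (mem_union_right _ hpar)) (by simp) (by omega) (by omega))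
    (Or.inl ⟨rfl, rfl⟩) ?_
  · refine Apart.mono (X := E.biUnion (below S par) ∪ (below S par b \ below S par y))
      (Y := (below S par y).erase y) ?_ Subset.rfl ?_
    · refine ((hB.apart hR).mono Subset.rfl ((erase_subset _ _).trans hyB)).union_left ?_
      intro v hv w hw
      rw [mem_sdiff] at hv
      rw [mem_erase] at hw
      refine ⟨fun e => hv.2 (e ▸ hw.2), fun ha => hw.1 ?_⟩
      exact (hR.edge_out hw.2 (below_subset _ hv.1) hv.2 ha.symm).1
    · refine Branch.erase_sdiff_subset.trans ?_
      intro v hv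
      simp only [mem_erase, mem_sdiff, not_and, not_not] at hv ⊢
      exact ⟨hv.1, hv.2.2 hv.2.1⟩
  · intro v hv ha
    rw [mem_singleton]
    rcases mem_union.1 hv with hv | hv
    · exact absurd ha (hB.apart hR v hv y hB.hy).2
    · rw [mem_sdiff] at hv
      exact (hR.edge_out hself (below_subset _ hv.1) hv.2 ha.symm).2

/-- Put the part below `y` under `u`, with the parent of `y` on `a`. -/
lemma Stage.fills_below (h : Stage Ho H U lo u m S z par rk) (hl : IsLeft Ho.L a u)
    (hlo : lo < a) {x b y : V} {E : Finset V} (hB : Branch S z par x b E y)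
    (hge : m + Ho.sz a ≤ ∑ c ∈ E, (below S par c).card + (below S par b).card + u + 1)
    (hle : ∑ c ∈ E, (below S par c).card + (below S par b).card + 2 * u + 2 ≤ 2 * m)
    (hyb : y ≠ b)
    (h1 : m ≤ ∑ c ∈ E, (below S par c).card + (below S par y).card + u + 1)
    (h2 : ∑ c ∈ E, (below S par c).card + (below S par y).card + u + 2 ≤ m + Ho.sz a) :
    FillsWith Ho H U lo u m S z x := by
  have hR := h.tree
  have hyB := below_trans hB.hy
  have hpar := mem_sdiff.1 (hB.par_mem hR hyb)
  have hself := self_mem_below (par := par) hB.y_mem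
  have hcE := hR.card_biUnion_kids hB.hE
  have hcR := card_union_of_disjoint ((hB.apart hR).mono Subset.rfl hyB).disjoint
  have hB' : Branch S z par x b E (par y) := { hB with hy := hpar.1 }
  refine h.fills_branch hl hlo hB' hge hle (hB.subset_erase hR hyB hpar.1 hpar.2)
    ?_ (good_of_single h.hS h.lt hl h.hum h.hmu (ζ := {y})
      (singleton_subset_iff.2 (mem_union_right _ hself)) (by simp) (by omega) (by omega))
    (Or.inl ⟨rfl, rfl⟩) ?_
  · refine Apart.mono (X := E.biUnion (below S par) ∪ below S par y)
      (Y := (below S par b \ below S par y).erase (par y)) ?_ Subset.rfl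
      Branch.erase_sdiff_subset
    refine ((hB.apart hR).mono Subset.rfl
      ((erase_subset _ _).trans sdiff_subset)).union_left ?_
    intro v hv w hw
    rw [mem_erase, mem_sdiff] at hw
    exact ⟨fun e => hw.2.2 (e ▸ hv), fun ha =>
      hw.1 (hR.edge_out hv (below_subset _ hw.2.1) hw.2.2 ha).2⟩
  · intro v hv ha
    rw [mem_singleton]
    rcases mem_union.1 hv with hv | hv
    · exact absurd ha (hB.apart hR v hv (par y) hpar.1).2
    · exact (hR.edge_out hv (below_subset _ hpar.1) hpar.2 ha).1

/-- Put `E` and some branches of `y` under `u` and `a`, with `y` on `u` and `x` on `a`. -/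
lemma Stage.fills_kids (h : Stage Ho H U lo u m S z par rk) (hl : IsLeft Ho.L a u)
    (hlo : lo < a) {x b y : V} {E J : Finset V} (hB : Branch S z par x b E y)
    (hge : m + Ho.sz a ≤ ∑ c ∈ E, (below S par c).card + (below S par y).card + u + 1)
    (hle : ∑ c ∈ E, (below S par c).card + (below S par y).card + 2 * u + 2 ≤ 2 * m)
    (hJ : J ⊆ kids S z par y)
    (hg : Good Ho H u a m (E.biUnion (below S par) ∪ J.biUnion (below S par)) E) :
    FillsWith Ho H U lo u m S z x := by
  have hR := h.tree
  have hyB := below_trans hB.hy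
  have hcE := hR.card_biUnion_kids hB.hE
  have hcy := hR.card_below hB.y_mem
  have hcK := hR.card_biUnion_kids (Subset.refl (kids S z par y))
  have hKB : (kids S z par y).biUnion (below S par) ⊆ below S par b := by
    refine Subset.trans ?_ hyB
    rw [hR.below_eq hB.y_mem]
    exact subset_insert _ _
  have hap := (hB.apart hR).mono Subset.rfl hKB
  have hc := card_union_of_disjoint hap.disjoint
  have hTS : E.biUnion (below S par) ∪ (kids S z par y).biUnion (below S par) ⊆ S :=
    union_subset (Rooted.biUnion_subset _) (Rooted.biUnion_subset _)
  have hJK := biUnion_subset_biUnion_of_subset_left (below S par) hJ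
  have hxB : x ∉ below S par b := hR.not_mem_below_kid hB.hb
  refine ⟨insert y (insert x
      (E.biUnion (below S par) ∪ (kids S z par y).biUnion (below S par))),
    Finset.insert_subset hB.y_mem (Finset.insert_subset hB.hx hTS), by simp,
    fills_of_good h.hS h.toWindow hl hlo h.hcard hTS hB.y_mem hB.hx (hB.ne hR) ?_ ?_ ?_ ?_
      (union_subset_union Subset.rfl hJK) ?_ hg ?_ (by omega) (by omega)⟩
  · rw [mem_union, not_or]
    exact ⟨hB.not_mem hR, hR.self_not_mem_kids Subset.rfl⟩
  · rw [mem_union, not_or]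
    exact ⟨hR.self_not_mem_kids hB.hE, fun hx => hxB (hKB hx)⟩
  · intro v hv w hw ha
    rw [mem_union]
    rcases mem_union.1 hv with hv | hv
    · have := hR.edge_kids hB.hE hv hw ha
      tauto
    · have := hR.edge_kids Subset.rfl hv hw ha
      tauto
  · rw [mem_union, not_or]
    exact ⟨hR.root_not_mem_kids hB.hE, hR.root_not_mem_kids Subset.rfl⟩
  · refine Apart.mono (X := E.biUnion (below S par) ∪ J.biUnion (below S par))
      (Y := (kids S z par y \ J).biUnion (below S par)) ?_ Subset.rfl ?_
    · exact (hap.mono Subset.rfl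
        (biUnion_subset_biUnion_of_subset_left _ sdiff_subset)).union_left
        ((hR.pieces Subset.rfl).biUnion_apart hJ sdiff_subset disjoint_sdiff)
    · intro v hv
      simp only [mem_sdiff, mem_union, mem_biUnion] at hv ⊢
      push Not at hv
      rcases hv.1 with ⟨c, hc, hvc⟩ | ⟨c, hc, hvc⟩
      · exact absurd hvc (hv.2.1 c hc)
      · exact ⟨c, ⟨hc, fun hcJ => hv.2.2 c hcJ hvc⟩, hvc⟩
  · intro v hv ha
    rcases mem_union.1 hv with hv | hv
    · exact hR.mem_of_adj_parent hB.hx hB.hE hv ha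
    · exfalso
      rcases hR.edge_kids hJ hv hB.hx ha with h1 | h1
      · exact hxB (hKB (hJK h1))
      · exact hB.ne hR h1.symm

/-- Put everything except some branches of `y` under `u` and `a`, with `y` on `u` and `x` on
`a`. -/
lemma Stage.fills_around (h : Stage Ho H U lo u m S z par rk) (hl : IsLeft Ho.L a u)
    (hlo : lo < a) {x b y : V} {E J : Finset V} (hB : Branch S z par x b E y)
    (hge : m + Ho.sz a ≤ ∑ c ∈ E, (below S par c).card + (below S par b).card + u + 1)
    (hle : ∑ c ∈ E, (below S par c).card + (below S par b).card + 2 * u + 2 ≤ 2 * m)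
    (hJ : J ⊆ kids S z par y)
    (hg : Good Ho H u a m (E.biUnion (below S par) ∪ ((below S par b \ below S par y) ∪
      J.biUnion (below S par))) (E ∪ {b})) :
    FillsWith Ho H U lo u m S z x := by
  have hR := h.tree
  have hyB := below_trans hB.hy
  have hself := self_mem_below (par := par) hB.y_mem
  have hbe := hR.below_eq hB.y_mem
  have hJy : J.biUnion (below S par) ⊆ below S par y := by
    rw [hbe]
    exact (biUnion_subset_biUnion_of_subset_left _ hJ).trans (subset_insert _ _)
  have hRB : (below S par b \ below S par y) ∪ J.biUnion (below S par) ⊆ below S par b :=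
    union_subset sdiff_subset (hJy.trans hyB)
  refine h.fills_branch hl hlo hB hge hle (hB.subset_erase hR hRB hB.hy ?_) ?_ hg
    (Or.inr ⟨rfl, rfl⟩) ?_
  · rw [mem_union, not_or]
    exact ⟨by simp [hself], hR.self_not_mem_kids hJ⟩
  · refine Apart.mono (X := E.biUnion (below S par) ∪ ((below S par b \ below S par y) ∪
      J.biUnion (below S par))) (Y := (kids S z par y \ J).biUnion (below S par)) ?_ Subset.rfl ?_
    · have hK : (kids S z par y \ J).biUnion (below S par) ⊆ below S par y := by
        rw [hbe]
        exact (biUnion_subset_biUnion_of_subset_left _ sdiff_subset).trans (subset_insert _ _)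
      refine ((hB.apart hR).mono Subset.rfl (hK.trans hyB)).union_left
        (Apart.union_left ?_
          ((hR.pieces Subset.rfl).biUnion_apart hJ sdiff_subset disjoint_sdiff))
      intro v hv w hw
      rw [mem_sdiff] at hv
      refine ⟨fun e => hv.2 (e ▸ hK hw), fun ha => hv.2 ?_⟩
      rcases hR.edge_kids sdiff_subset hw (below_subset _ hv.1) ha.symm with h1 | h1
      · exact hK h1
      · exact h1 ▸ hself
    · refine Branch.erase_sdiff_subset.trans ?_
      intro v hv
      simp only [mem_erase, mem_sdiff, mem_union, not_or, not_and, not_not] at hv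
      have h1 := hv.2.2.1 hv.2.1
      rw [hbe, mem_insert] at h1
      obtain ⟨c, hc, hvc⟩ := mem_biUnion.1 (h1.resolve_left hv.1)
      exact mem_biUnion.2 ⟨c, mem_sdiff.2 ⟨hc, fun hcJ => hv.2.2.2 (mem_biUnion.2 ⟨c, hcJ, hvc⟩)⟩,
        hvc⟩
  · intro v hv ha
    rw [mem_union, mem_singleton]
    rcases mem_union.1 hv with hv | hv
    · exact Or.inl (hR.mem_of_adj_parent hB.hx hB.hE hv ha)
    · exact Or.inr (hR.edge_out (hRB hv) hB.hx (hR.not_mem_below_kid hB.hb) ha).1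

end StepCases

section Split

open Finset

variable {V : Type*} [DecidableEq V] {N : ℕ} {Ho : Host N} {H : SimpleGraph V}
  {S : Finset V} {z : V} {par : V → V} {rk : V → ℕ} {U lo u m a : ℕ}

open Rooted

lemma Branch.apart_kid {x b y e c : V} {E : Finset V} (hB : Branch S z par x b E y)
    (hR : Rooted H S z par rk) (he : e ∈ E) (hc : c ∈ kids S z par y) :
    Apart H (below S par e) (below S par c) :=
  (hB.apart hR).mono (subset_biUnion_of_mem _ he)
    ((below_trans (kid_mem_below hB.y_mem hc)).trans (below_trans hB.hy))

lemma Stage.good_kids_one (h : Stage Ho H U lo u m S z par rk) (hl : IsLeft Ho.L a u)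
    {x b y e : V} (hB : Branch S z par x b {e} y)
    (hE : (below S par e).card + u + 2 ≤ m)
    (hy : m ≤ (below S par e).card + (below S par y).card + u)
    (hk : ∀ c ∈ kids S z par y, (below S par c).card ≤ Ho.sz a) :
    ∃ J ⊆ kids S z par y,
      Good Ho H u a m (({e} : Finset V).biUnion (below S par) ∪ J.biUnion (below S par)) {e} := by
  have hR := h.tree
  have hcy := hR.card_below hB.y_mem
  have hes : e ∈ S := (mem_kids.1 (hB.hE (mem_singleton_self e))).1
  rw [singleton_biUnion]
  exact good_one h.hS h.lt hl _ h.hum h.hmu (hR.pieces Subset.rfl)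
    (fun c hc => hB.apart_kid hR (mem_singleton_self e) hc)
    (singleton_subset_iff.2 (self_mem_below hes)) (by simp) (by omega) (by omega) hk

lemma Stage.good_kids_big (h : Stage Ho H U lo u m S z par rk) (hl : IsLeft Ho.L a u)
    {x b y e c₁ : V} (hB : Branch S z par x b {e} y) (hc₁ : c₁ ∈ kids S z par y)
    (hE : (below S par e).card + (below S par c₁).card + u + 2 ≤ m)
    (hy : m ≤ (below S par e).card + (below S par y).card + u)
    (hk : ∀ c ∈ kids S z par y, c ≠ c₁ → (below S par c).card ≤ Ho.sz a) :
    ∃ J ⊆ kids S z par y,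
      Good Ho H u a m (({e} : Finset V).biUnion (below S par) ∪ J.biUnion (below S par)) {e} := by
  have hR := h.tree
  have hcy := hR.card_below hB.y_mem
  have hes : e ∈ S := (mem_kids.1 (hB.hE (mem_singleton_self e))).1
  have hap := hB.apart_kid hR (mem_singleton_self e) hc₁
  have hcu := card_union_of_disjoint hap.disjoint
  have hsum := sum_erase_card (Pc := below S par) hc₁
  obtain ⟨J, hJ, hg⟩ := good_one h.hS h.lt hl (below S par) (I := (kids S z par y).erase c₁)
    (S := below S par e ∪ below S par c₁) (ζ := {e}) h.hum h.hmu
    (hR.pieces (erase_subset _ _))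
    (fun c hc => (hB.apart_kid hR (mem_singleton_self e) (mem_of_mem_erase hc)).union_left
      (hR.kids_sep hc₁ (mem_of_mem_erase hc) (ne_of_mem_erase hc).symm))
    (singleton_subset_iff.2 (mem_union_left _ (self_mem_below hes))) (by simp) (by omega)
    (by omega) (fun c hc => hk c (mem_of_mem_erase hc) (ne_of_mem_erase hc))
  refine ⟨insert c₁ J, Finset.insert_subset hc₁ (hJ.trans (erase_subset _ _)),
    hg.congr ?_ rfl⟩
  rw [singleton_biUnion, biUnion_insert, union_assoc]

lemma Stage.good_kids_two (h : Stage Ho H U lo u m S z par rk) (hl : IsLeft Ho.L a u)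
    {x b y e₁ e₂ : V} {q : ℕ} (he : e₁ ≠ e₂) (hB : Branch S z par x b {e₁, e₂} y)
    (hE : (below S par e₁).card + (below S par e₂).card + 2 * q + u + 1 ≤ m + Ho.sz a)
    (hE' : (below S par e₁).card + (below S par e₂).card + u + 2 ≤ m)
    (hy : m + Ho.sz a ≤ (below S par e₁).card + (below S par e₂).card +
      (below S par y).card + u + 1)
    (hq : 2 * q ≤ Ho.sz a) (hk : ∀ c ∈ kids S z par y, (below S par c).card ≤ q) :
    ∃ J ⊆ kids S z par y, Good Ho H u a m
      (({e₁, e₂} : Finset V).biUnion (below S par) ∪ J.biUnion (below S par)) {e₁, e₂} := by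
  have hR := h.tree
  have hcy := hR.card_below hB.y_mem
  have m1 : e₁ ∈ ({e₁, e₂} : Finset V) := by simp
  have m2 : e₂ ∈ ({e₁, e₂} : Finset V) := by simp
  have hsub : ∀ e ∈ ({e₁, e₂} : Finset V), {e} ⊆ below S par e := fun e he =>
    singleton_subset_iff.2 (self_mem_below (mem_kids.1 (hB.hE he)).1)
  obtain ⟨J, hJ, hg⟩ := good_two h.hS h.lt hl
    { um := h.hum
      mu := h.hmu
      pieces := hR.pieces (Subset.refl (kids S z par y))
      s1 := fun c hc => hB.apart_kid hR m1 hc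
      s2 := fun c hc => hB.apart_kid hR m2 hc
      s12 := hR.kids_sep (hB.hE m1) (hB.hE m2) he
      z1 := hsub _ m1
      z2 := hsub _ m2
      z1c := by simp
      z2c := by simp
      le := by omega
      ge := by omega
      piece_le := hk
      two_q := hq
      inv := Or.inl hE : TwoParts Ho H u a _ q m _ _ {e₁} _ {e₂} }
  refine ⟨J, hJ, hg.congr ?_ (by ext; simp)⟩
  rw [biUnion_insert, singleton_biUnion, union_assoc]

lemma Stage.good_kids_three (h : Stage Ho H U lo u m S z par rk) (hl : IsLeft Ho.L a u)
    {x b y e₁ e₂ e₃ : V} {q : ℕ} (h12 : e₁ ≠ e₂) (h13 : e₁ ≠ e₃) (h23 : e₂ ≠ e₃)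
    (hB : Branch S z par x b {e₁, e₂, e₃} y)
    (hE : (below S par e₁).card + (below S par e₂).card + (below S par e₃).card + u + 2 ≤ m)
    (hy : m + Ho.sz a ≤ (below S par e₁).card + (below S par e₂).card +
      (below S par e₃).card + (below S par y).card + u + 1)
    (hq : 7 * q + 5 ≤ Ho.sz a) (hk : ∀ c ∈ kids S z par y, (below S par c).card ≤ q) :
    ∃ J ⊆ kids S z par y, Good Ho H u a m
      (({e₁, e₂, e₃} : Finset V).biUnion (below S par) ∪ J.biUnion (below S par))
      {e₁, e₂, e₃} := by
  have hR := h.tree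
  have hcy := hR.card_below hB.y_mem
  have m1 : e₁ ∈ ({e₁, e₂, e₃} : Finset V) := by simp
  have m2 : e₂ ∈ ({e₁, e₂, e₃} : Finset V) := by simp
  have m3 : e₃ ∈ ({e₁, e₂, e₃} : Finset V) := by simp
  have hsub : ∀ e ∈ ({e₁, e₂, e₃} : Finset V), {e} ⊆ below S par e := fun e he =>
    singleton_subset_iff.2 (self_mem_below (mem_kids.1 (hB.hE he)).1)
  obtain ⟨J, hJ, hg⟩ := good_three h.hS h.lt hl
    { um := h.hum
      mu := h.hmu
      pieces := hR.pieces (Subset.refl (kids S z par y))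
      s1 := fun c hc => hB.apart_kid hR m1 hc
      s2 := fun c hc => hB.apart_kid hR m2 hc
      s3 := fun c hc => hB.apart_kid hR m3 hc
      s12 := hR.kids_sep (hB.hE m1) (hB.hE m2) h12
      s13 := hR.kids_sep (hB.hE m1) (hB.hE m3) h13
      s23 := hR.kids_sep (hB.hE m2) (hB.hE m3) h23
      z1 := hsub _ m1
      z2 := hsub _ m2
      z3 := hsub _ m3
      z1c := by simp
      z2c := by simp
      z3c := by simp
      le := by omega
      ge := by omega
      piece_le := hk
      seven_q := hq
      inv := Or.inl hE : ThreeParts Ho H u a _ q m _ _ {e₁} _ {e₂} _ {e₃} }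
  refine ⟨J, hJ, hg.congr ?_ rfl⟩
  rw [biUnion_insert, biUnion_insert, singleton_biUnion]
  simp only [union_assoc]

/-- The numerical situation when no set of children has the right total size: `E` falls short by
`s`, and even the smallest unused branch `b` overshoots by more than the size of `a`. -/
structure Overshoot (Ho : Host N) (S : Finset V) (z : V) (par : V → V) (u a m : ℕ) (x b : V)
    (E : Finset V) (s : ℕ) : Prop where
  hx : x ∈ S
  hE : E ⊆ kids S z par x
  hb : b ∈ kids S z par x
  hbE : b ∉ E
  short : ∑ c ∈ E, (below S par c).card + s + u + 1 = m
  pos : 1 ≤ s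
  excess : s + Ho.sz a ≤ (below S par b).card
  b_le : (below S par b).card + u + 1 ≤ m
  le_e : ∀ e ∈ E, (below S par b).card ≤ (below S par e).card
  a_pos : 1 ≤ Ho.sz a
  le_four : m ≤ u + 4 * Ho.sz a

namespace Overshoot

variable {x b y : V} {E : Finset V} {s : ℕ}

lemma branch (ho : Overshoot Ho S z par u a m x b E s) (hy : y ∈ below S par b) :
    Branch S z par x b E y := ⟨ho.hx, ho.hE, ho.hb, ho.hbE, hy⟩

lemma card_mul_le (ho : Overshoot Ho S z par u a m x b E s) :
    E.card * (below S par b).card ≤ ∑ c ∈ E, (below S par c).card := by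
  simpa using card_nsmul_le_sum E _ _ ho.le_e

lemma card_pos (ho : Overshoot Ho S z par u a m x b E s) : 1 ≤ E.card := by
  by_contra hc
  have he : E = ∅ := card_eq_zero.1 (by omega)
  have h1 := ho.short
  have h2 := ho.excess
  have h3 := ho.b_le
  have h4 := ho.a_pos
  rw [he, sum_empty] at h1
  omega

lemma card_le (ho : Overshoot Ho S z par u a m x b E s) : E.card ≤ 3 := by
  by_contra hc
  have h1 := ho.short
  have h2 := ho.excess
  have h4 := ho.le_four
  have h5 := ho.card_mul_le
  have h6 := Nat.mul_le_mul_right (below S par b).card (show 4 ≤ E.card by omega)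
  omega

lemma card_eq_one (ho : Overshoot Ho S z par u a m x b E s) (hs : Ho.sz a + 2 ≤ s) :
    E.card = 1 := by
  by_contra hc
  have h1 := ho.short
  have h2 := ho.excess
  have h4 := ho.le_four
  have h5 := ho.card_mul_le
  have h7 := ho.card_pos
  have h6 := Nat.mul_le_mul_right (below S par b).card (show 2 ≤ E.card by omega)
  omega

end Overshoot

lemma Stage.fills_small (h : Stage Ho H U lo u m S z par rk) (hl : IsLeft Ho.L a u)
    (hlo : lo < a) {x b y : V} {E : Finset V} {s : ℕ}
    (ho : Overshoot Ho S z par u a m x b E s) (hs : s ≤ Ho.sz a + 1) (hy : y ∈ below S par b)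
    (hys : s + Ho.sz a ≤ (below S par y).card)
    (hk : ∀ c ∈ kids S z par y, (below S par c).card + 1 ≤ s ∧
      (below S par c).card + s + Ho.sz a ≤ (below S par b).card) :
    FillsWith Ho H U lo u m S z x := by
  have hB := ho.branch hy
  have hR := h.tree
  have hyb := card_le_card (below_trans hy)
  have h1 := ho.short
  have h2 := ho.excess
  have h3 := ho.b_le
  have h4 := ho.a_pos
  have h5 := ho.le_four
  have h6 := ho.pos
  have h7 := ho.le_e
  suffices hsuff : ∃ J ⊆ kids S z par y,
      Good Ho H u a m (E.biUnion (below S par) ∪ J.biUnion (below S par)) E by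
    obtain ⟨J, hJ, hg⟩ := hsuff
    exact h.fills_kids hl hlo hB (by omega) (by omega) hJ hg
  obtain ⟨c₀, hc₀, hmax⟩ : ∃ c₀ ∈ kids S z par y, ∀ c ∈ kids S z par y,
      (below S par c).card ≤ (below S par c₀).card := by
    refine exists_max_image _ _ (nonempty_iff_ne_empty.2 fun he => ?_)
    have := hR.card_below hB.y_mem
    rw [he, sum_empty] at this
    omega
  have hq := hk c₀ hc₀
  have hc1 := ho.card_pos
  have hc3 := ho.card_le
  obtain hc | hc | hc : E.card = 1 ∨ E.card = 2 ∨ E.card = 3 := by omega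
  · obtain ⟨e, rfl⟩ := card_eq_one.1 hc
    rw [sum_singleton] at h1
    exact h.good_kids_one hl hB (by omega) (by omega)
      (fun c hc => (hmax c hc).trans (by omega))
  · obtain ⟨e₁, e₂, he, rfl⟩ := card_eq_two.1 hc
    rw [sum_pair he] at h1
    have := h7 e₁ (by simp)
    have := h7 e₂ (by simp)
    exact h.good_kids_two hl he hB (by omega) (by omega) (by omega) (by omega) hmax
  · obtain ⟨e₁, e₂, e₃, h12, h13, h23, rfl⟩ := card_eq_three.1 hc
    rw [sum_insert (by simp [h12, h13]), sum_pair h23] at h1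
    have := h7 e₁ (by simp)
    have := h7 e₂ (by simp)
    have := h7 e₃ (by simp)
    exact h.good_kids_three hl h12 h13 h23 hB (by omega) (by omega) (by omega) hmax

/-- With two large children `c₂`, `c₃` of `y`, cut inside the smaller one. -/
lemma Stage.fills_two_big (h : Stage Ho H U lo u m S z par rk) (hl : IsLeft Ho.L a u)
    (hlo : lo < a) {x b y : V} {E : Finset V} {s : ℕ}
    (ho : Overshoot Ho S z par u a m x b E s) (hs : Ho.sz a + 2 ≤ s) (hy : y ∈ below S par b)
    (hnD : ∀ w ∈ below S par b, s + (below S par w).card ≤ (below S par b).card →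
      (below S par w).card + s + Ho.sz a ≤ (below S par b).card)
    {c₂ c₃ : V} (hc₂ : c₂ ∈ kids S z par y) (hc₃ : c₃ ∈ kids S z par y) (hcc : c₂ ≠ c₃)
    (hbig : Ho.sz a + 1 ≤ (below S par c₃).card)
    (hle : (below S par c₃).card ≤ (below S par c₂).card)
    (hk : (below S par c₂).card + 1 ≤ s) :
    FillsWith Ho H U lo u m S z x := by
  have hR := h.tree
  have hyb := card_le_card (below_trans hy)
  have h1 := ho.short
  have h2 := ho.excess
  have h3 := ho.b_le
  have h4 := ho.a_pos
  have h5 := ho.le_four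
  have h7 := ho.le_e
  obtain ⟨e, rfl⟩ := card_eq_one.1 (ho.card_eq_one hs)
  rw [sum_singleton] at h1
  have he := h7 e (by simp)
  have hyS := (ho.branch hy).y_mem
  have hc3y := below_trans (kid_mem_below hyS hc₃)
  have h23 : (below S par c₂).card + (below S par c₃).card + 1 ≤ (below S par y).card := by
    rw [hR.card_below hyS]
    have := sum_le_sum_of_subset (f := fun c => (below S par c).card)
      (Finset.insert_subset hc₂ (singleton_subset_iff.2 hc₃))
    rw [sum_pair hcc] at this
    omega
  obtain ⟨w, hw, hmin⟩ := exists_min_image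
    ((below S par c₃).filter (fun w =>
      (below S par b).card + 1 ≤ (below S par w).card + s + Ho.sz a))
    (fun w => (below S par w).card)
    ⟨c₃, mem_filter.2 ⟨self_mem_below (mem_kids.1 hc₃).1, by omega⟩⟩
  rw [mem_filter] at hw
  have hwb : w ∈ below S par b := below_trans hy (hc3y hw.1)
  have hB := ho.branch hwb
  have hwS := hB.y_mem
  have hwc := card_le_card (below_trans hw.1)
  have hwD := hnD w hwb
  have hcw := hR.card_below hwS
  have hkw : ∀ c ∈ kids S z par w,
      (below S par c).card + s + Ho.sz a ≤ (below S par b).card := by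
    intro c hc
    by_contra hcon
    have h8 := hR.card_lt_of_kid hwS hc
    have h9 := hmin c (mem_filter.2 ⟨below_trans hw.1 (kid_mem_below hwS hc), by omega⟩)
    omega
  obtain ⟨c₀, hc₀, hmax⟩ : ∃ c₀ ∈ kids S z par w, ∀ c ∈ kids S z par w,
      (below S par c).card ≤ (below S par c₀).card := by
    refine exists_max_image _ _ (nonempty_iff_ne_empty.2 fun he => ?_)
    rw [he, sum_empty] at hcw
    omega
  have hq := hkw c₀ hc₀
  have hwB := below_trans hwb
  have hcd := card_sdiff_add_card_eq_card hwB
  have hbw : b ∉ below S par w := by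
    intro hbw
    exact hR.not_mem_below_kid hc₃ (below_trans (below_trans hw.1 hbw) hy)
  have hbS := (mem_kids.1 ho.hb).1
  have heS := (mem_kids.1 (ho.hE (mem_singleton_self e))).1
  have hap := hB.apart hR
  rw [singleton_biUnion] at hap
  obtain ⟨J, hJ, hg⟩ := good_two h.hS h.lt hl
    { um := h.hum
      mu := h.hmu
      pieces := hR.pieces (Subset.refl (kids S z par w))
      s1 := fun c hc => hB.apart_kid hR (mem_singleton_self e) hc
      s2 := by
        intro c hc
        have hcw := below_trans (kid_mem_below hwS hc)
        intro v hv d hd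
        rw [mem_sdiff] at hv
        refine ⟨fun e => hv.2 (e ▸ hcw hd), fun ha => hv.2 ?_⟩
        by_contra hvw
        rw [(hR.edge_out hd (below_subset _ hv.1) (fun h' => hvw (hcw h')) ha.symm).2,
          (mem_kids.1 hc).2.2] at hvw
        exact hvw (self_mem_below hwS)
      s12 := hap.mono Subset.rfl sdiff_subset
      z1 := singleton_subset_iff.2 (self_mem_below heS)
      z2 := singleton_subset_iff.2 (mem_sdiff.2 ⟨self_mem_below hbS, hbw⟩)
      z1c := by simp
      z2c := by simp
      le := by omega
      ge := by omega
      piece_le := hmax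
      two_q := by omega
      inv := by
        left
        omega : TwoParts Ho H u a (below S par) (below S par c₀).card m _
          (below S par e) {e} (below S par b \ below S par w) {b} }
  refine h.fills_around hl hlo hB (by rw [sum_singleton]; omega) (by rw [sum_singleton]; omega) hJ
    (hg.congr ?_ rfl)
  rw [singleton_biUnion]

/-- Some part of `S` containing `x` fills the window when the branches of `x` overshoot. -/
lemma Stage.fills_overshoot (h : Stage Ho H U lo u m S z par rk) (hl : IsLeft Ho.L a u)
    (hlo : lo < a) {x b : V} {E : Finset V} {s : ℕ}
    (ho : Overshoot Ho S z par u a m x b E s) : FillsWith Ho H U lo u m S z x := by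
  have hR := h.tree
  have h1 := ho.short
  have h2 := ho.excess
  have h3 := ho.b_le
  have h4 := ho.a_pos
  have h6 := ho.pos
  by_cases hD : ∃ w ∈ below S par b, s + (below S par w).card ≤ (below S par b).card ∧
      (below S par b).card + 1 ≤ (below S par w).card + s + Ho.sz a
  · obtain ⟨w, hw, hw1, hw2⟩ := hD
    refine h.fills_above hl hlo (ho.branch hw) (by omega) (by omega) ?_ (by omega) (by omega)
    rintro rfl
    omega
  have hnD : ∀ w ∈ below S par b, s + (below S par w).card ≤ (below S par b).card →
      (below S par w).card + s + Ho.sz a ≤ (below S par b).card := by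
    intro w hw hw1
    by_contra hw2
    exact hD ⟨w, hw, hw1, by omega⟩
  obtain ⟨y, hy, hmin⟩ := exists_min_image
    ((below S par b).filter (fun w => s ≤ (below S par w).card)) (fun w => (below S par w).card)
    ⟨b, mem_filter.2 ⟨self_mem_below (mem_kids.1 ho.hb).1, by omega⟩⟩
  rw [mem_filter] at hy
  have hB := ho.branch hy.1
  have hyb := card_le_card (below_trans hy.1)
  by_cases hys : (below S par y).card + 1 ≤ s + Ho.sz a
  · refine h.fills_below hl hlo hB (by omega) (by omega) ?_ (by omega) (by omega)
    rintro rfl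
    omega
  have hkm : ∀ c ∈ kids S z par y, c ∈ below S par b := fun c hc =>
    below_trans hy.1 (kid_mem_below hB.y_mem hc)
  have hks : ∀ c ∈ kids S z par y, (below S par c).card + 1 ≤ s := by
    intro c hc
    by_contra hcon
    have h8 := hR.card_lt_of_kid hB.y_mem hc
    have h9 := hmin c (mem_filter.2 ⟨hkm c hc, by omega⟩)
    omega
  by_cases hs : s ≤ Ho.sz a + 1
  · refine h.fills_small hl hlo ho hs hy.1 (by omega) (fun c hc => ⟨hks c hc, ?_⟩)
    have := hks c hc
    exact hnD c (hkm c hc) (by omega)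
  by_cases hbig : ∃ c₂ ∈ kids S z par y, ∃ c₃ ∈ kids S z par y, c₂ ≠ c₃ ∧
      Ho.sz a + 1 ≤ (below S par c₂).card ∧ Ho.sz a + 1 ≤ (below S par c₃).card
  · obtain ⟨c₂, hc₂, c₃, hc₃, hcc, hb2, hb3⟩ := hbig
    rcases le_total (below S par c₃).card (below S par c₂).card with hle | hle
    · exact h.fills_two_big hl hlo ho (by omega) hy.1 hnD hc₂ hc₃ hcc hb3 hle (hks _ hc₂)
    · exact h.fills_two_big hl hlo ho (by omega) hy.1 hnD hc₃ hc₂ hcc.symm hb2 hle (hks _ hc₃)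
  obtain ⟨e, rfl⟩ := card_eq_one.1 (ho.card_eq_one (by omega))
  obtain ⟨J, hJ, hg⟩ : ∃ J ⊆ kids S z par y,
      Good Ho H u a m (({e} : Finset V).biUnion (below S par) ∪ J.biUnion (below S par)) {e} := by
    rw [sum_singleton] at h1
    by_cases hone : ∃ c₁ ∈ kids S z par y, Ho.sz a + 1 ≤ (below S par c₁).card
    · obtain ⟨c₁, hc₁, hb1⟩ := hone
      have := hks c₁ hc₁
      refine h.good_kids_big hl hB hc₁ (by omega) (by omega) (fun c hc hcc => ?_)
      by_contra hcon
      exact hbig ⟨c, hc, c₁, hc₁, hcc, by omega, hb1⟩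
    · refine h.good_kids_one hl hB (by omega) (by omega) (fun c hc => ?_)
      by_contra hcon
      exact hone ⟨c, hc, by omega⟩
  exact h.fills_kids hl hlo hB (by omega) (by omega) hJ hg

end Split

section Level

open Finset

variable {V : Type*} [DecidableEq V] {N : ℕ} {Ho : Host N} {H : SimpleGraph V}
  {S : Finset V} {z : V} {par : V → V} {rk : V → ℕ} {U lo u m : ℕ}

open Rooted

lemma Stage.fills (h : Stage Ho H U lo u m S z par rk) (hm : m ≤ u + S.card) :
    ∃ x, m ≤ u + (below S par x).card ∧ FillsWith Ho H U lo u m S z x := by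
  have hR := h.tree
  obtain ⟨x, hx, hmin⟩ := exists_min_image
    (S.filter (fun x => m ≤ u + (below S par x).card)) (fun x => (below S par x).card)
    ⟨z, mem_filter.2 ⟨hR.root_mem, by rwa [hR.below_root]⟩⟩
  rw [mem_filter] at hx
  have hcx := hR.card_below hx.1
  have hxS := card_le_card (below_subset (S := S) (par := par) x)
  have hk : ∀ c ∈ kids S z par x, (below S par c).card + u + 1 ≤ m := by
    intro c hc
    by_contra hcon
    have h1 := hR.card_lt_of_kid hx.1 hc
    have h2 := hmin c (mem_filter.2 ⟨(mem_kids.1 hc).1, by omega⟩)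
    omega
  refine ⟨x, hx.2, ?_⟩
  obtain ⟨Z, hZ, hZmin⟩ := exists_min_image ((kids S z par x).powerset.filter
    (fun Z => m ≤ ∑ c ∈ Z, (below S par c).card + u + 1)) (fun Z => Z.card)
    ⟨kids S z par x, mem_filter.2 ⟨mem_powerset_self _, by omega⟩⟩
  rw [mem_filter, mem_powerset] at hZ
  have hZx := sum_le_sum_of_subset (f := fun c => (below S par c).card) hZ.1
  by_cases heq : ∑ c ∈ Z, (below S par c).card + u + 1 = m
  · exact h.fills_eq hx.1 hZ.1 heq
  obtain ⟨a, hl, hlo⟩ := h.exists_left (by omega)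
  by_cases hle : ∑ c ∈ Z, (below S par c).card + u + 2 ≤ m + Ho.sz a
  · exact h.fills_le hl hlo hx.1 hZ.1 hZ.2 hle
  have hum := h.hum
  obtain ⟨b, hb, hbmin⟩ := exists_min_image Z (fun c => (below S par c).card)
    (nonempty_iff_ne_empty.2 fun he => heq (by
      have := hZ.2
      rw [he, sum_empty] at this ⊢
      omega))
  have hsum := sum_erase_card (Pc := below S par) hb
  have hshort : ∑ c ∈ Z.erase b, (below S par c).card + u + 2 ≤ m := by
    by_contra hcon
    have h1 := hZmin (Z.erase b) (mem_filter.2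
      ⟨mem_powerset.2 ((erase_subset _ _).trans hZ.1), by omega⟩)
    have h2 := card_erase_lt_of_mem hb
    omega
  have hu := h.lt
  have hmu := h.hmu
  have h4 := Ho.sz_le_mul a u hu hl
  exact h.fills_overshoot hl hlo (E := Z.erase b) (b := b)
    (s := m - u - 1 - ∑ c ∈ Z.erase b, (below S par c).card)
    { hx := hx.1
      hE := (erase_subset _ _).trans hZ.1
      hb := hZ.1 hb
      hbE := notMem_erase _ _
      short := by omega
      pos := by omega
      excess := by omega
      b_le := hk b (hZ.1 hb)
      le_e := fun e he => hbmin e (mem_of_mem_erase he)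
      a_pos := Ho.sz_pos a (hl.1.trans hu)
      le_four := by omega }

lemma stepAt_of_deeper (hH : H.IsTree) (hS : ∀ U', Ho.L U + 1 ≤ Ho.L U' → StepAt Ho H U') :
    StepAt Ho H U := by
  intro hU lo u m S z hlo hUu hum hmu hmU hL hz hm hcard
  obtain ⟨par, rk, hR⟩ := exists_rooted hH hz
  have h : Stage Ho H U lo u m S z par rk :=
    { hU := hU
      hlo := hlo
      hUu := hUu
      hum := hum
      hmu := hmu
      hmU := hmU
      hL := hL
      hS := by rwa [hL]
      hcard := hcard
      tree := hR }
  obtain ⟨x, hx, Us, hUs, hxU, f, m', hlm, hmm, hf, hout, hfz⟩ := h.fills hm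
  refine ⟨Us, hUs, f, m', hlm, hmm, hf, hout, hfz, fun hX => ?_⟩
  by_contra hzU
  have hxz : x ≠ z := fun e => hzU (e ▸ hxU)
  have := hX _ (below_subset x) (hR.conn_below hxz)
  omega

lemma stepAt (hH : H.IsTree) (U : ℕ) : StepAt Ho H U := by
  have key : ∀ k U, (range N).sup Ho.L < Ho.L U + k → StepAt Ho H U := by
    intro k
    induction k with
    | zero =>
      intro U hk hU
      have := le_sup (f := Ho.L) (mem_range.2 hU)
      omega
    | succ k ih =>
      exact fun U hk => stepAt_of_deeper hH fun U' hU' => ih U' (by omega)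
  exact key ((range N).sup Ho.L + 1) U (by omega)

/-- Every tree on `N` vertices embeds in the graph of a host on `N` indices. -/
theorem Host.contains_tree [Fintype V] (hN : 1 ≤ N) (h0 : Ho.sz 0 = N) (hH : H.IsTree)
    (hV : Fintype.card V = N) :
    ∃ f : V → ℕ, Function.Injective f ∧ (∀ v, f v < N) ∧
      ∀ v w, H.Adj v w → Ho.G.Adj (f v) (f w) := by
  obtain ⟨v⟩ : Nonempty V := Fintype.card_pos_iff.1 (by omega)
  have hc : (univ.erase v).card = N - 1 := by
    rw [card_erase_of_mem (mem_univ v), card_univ, hV]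
  obtain ⟨f, hf⟩ := fill_one (Ho := Ho) (H := H) (U := 0) (m := N) (ℓ := 0)
    (fun U _ => stepAt hH U) (Nat.zero_le _) hN (by omega) (S := univ.erase v) (by omega)
  rw [hc, show N - (N - 1) = 1 by omega] at hf
  obtain ⟨k, hk, -, -⟩ := (Emb.singleton (H := H) (G := Ho.G) v 0).union hf
    (by simp) (by simp) (by
      intro _ _ w hw _
      have := mem_Ico.1 (hf.mem hw)
      exact Ho.desc 0 _ hN (by omega) (by omega))
  have hmem : ∀ w, w ∈ {v} ∪ univ.erase v := by simp
  refine ⟨k, fun w w' e => hk.inj (hmem w) (hmem w') e, fun w => ?_,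
    fun w w' e => hk.adj w (hmem w) w' (hmem w') e⟩
  have := hk.mem (hmem w)
  simp only [mem_union, mem_singleton, mem_Ico] at this
  omega

end Level

namespace DFSTree

variable {N : ℕ} (T : DFSTree N)

lemma level_zero : T.level 0 = 0 :=
  Nat.sInf_eq_zero.2 (Or.inl rfl)

lemma exists_iterate_eq_zero {u : ℕ} (hu : u < N) : ∃ k, T.parent^[k] u = 0 := by
  induction u using Nat.strong_induction_on with
  | _ u ih =>
    rcases Nat.eq_zero_or_pos u with rfl | h
    · exact ⟨0, rfl⟩
    · have h1 := T.parent_lt u h hu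
      obtain ⟨k, hk⟩ := ih _ h1 (h1.trans hu)
      exact ⟨k + 1, hk⟩

lemma level_parent {u : ℕ} (h : 0 < u) (hu : u < N) :
    T.level u = T.level (T.parent u) + 1 := by
  have h1 : T.parent^[T.level u] u = 0 := Nat.sInf_mem (T.exists_iterate_eq_zero hu)
  have h2 : T.parent^[T.level (T.parent u)] (T.parent u) = 0 :=
    Nat.sInf_mem (T.exists_iterate_eq_zero ((T.parent_lt u h hu).trans hu))
  have h3 : T.level u ≤ T.level (T.parent u) + 1 := Nat.sInf_le h2
  obtain ⟨k, hk⟩ : ∃ k, T.level u = k + 1 := by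
    refine Nat.exists_eq_succ_of_ne_zero fun h0 => ?_
    rw [h0, Function.iterate_zero_apply] at h1
    omega
  rw [hk, Function.iterate_succ_apply] at h1
  have h4 : T.level (T.parent u) ≤ k := Nat.sInf_le h1
  omega

lemma self_mem_descCl {u : ℕ} (hu : u < N) : u ∈ T.descCl u := ⟨hu, 0, rfl⟩

variable {T}

lemma mem_descCl_trans {u v w : ℕ} (h : w ∈ T.descCl v) (h' : v ∈ T.descCl u) :
    w ∈ T.descCl u := by
  obtain ⟨hw, k, rfl⟩ := h
  obtain ⟨-, j, hj⟩ := h'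
  exact ⟨hw, j + k, by rw [Function.iterate_add_apply, hj]⟩

lemma parent_mem_descCl {u w : ℕ} (h : w ∈ T.descCl u) (hwu : w ≠ u) :
    0 < w ∧ T.parent w ∈ T.descCl u := by
  obtain ⟨hw, k, hk⟩ := h
  have hpos : 0 < w := by
    refine Nat.pos_of_ne_zero ?_
    rintro rfl
    rw [Function.iterate_fixed T.parent_zero] at hk
    exact hwu hk
  refine ⟨hpos, (T.parent_lt w hpos hw).trans hw, ?_⟩
  cases k with
  | zero => exact absurd hk hwu
  | succ k => exact ⟨k, hk⟩

lemma mem_descCl_parent {w : ℕ} (hw : w < N) : w ∈ T.descCl (T.parent w) := ⟨hw, 1, rfl⟩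

lemma lt_and_level_lt {u w : ℕ} (h : w ∈ T.descCl u) (hwu : w ≠ u) :
    u < w ∧ T.level u < T.level w := by
  induction w using Nat.strong_induction_on with
  | _ w ih =>
    obtain ⟨hpos, hp⟩ := parent_mem_descCl h hwu
    have h1 := T.parent_lt w hpos h.1
    have h2 := T.level_parent hpos h.1
    by_cases hpu : T.parent w = u
    · rw [hpu] at h1 h2
      omega
    · have := ih _ h1 hp hpu
      omega

lemma le_of_mem {u w : ℕ} (h : w ∈ T.descCl u) : u ≤ w := by
  by_cases hwu : w = u
  · exact hwu.ge
  · exact (lt_and_level_lt h hwu).1.le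

lemma pred_mem_descCl {u w : ℕ} (h : w + 1 ∈ T.descCl u) (hwu : u < w + 1) :
    w ∈ T.descCl u := by
  obtain ⟨hpos, hp⟩ := parent_mem_descCl h hwu.ne'
  have hw := h.1
  exact mem_descCl_trans ⟨by omega, T.preorder_chain (w + 1) hpos h.1⟩ hp

lemma mem_descCl_of_le {u w x : ℕ} (h : w ∈ T.descCl u) (hx : u ≤ x) (hxw : x ≤ w) :
    x ∈ T.descCl u := by
  induction w, hxw using Nat.le_induction with
  | base => exact h
  | succ w hw ih => exact ih (pred_mem_descCl h (by omega))

lemma mem_descCl_iff {u w : ℕ} (hu : u < N) :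
    w ∈ T.descCl u ↔ u ≤ w ∧ w < u + (T.descCl u).ncard := by
  classical
  have hex : ∃ M, u ≤ M ∧ M ∉ T.descCl u := ⟨N, hu.le, fun h => h.1.false⟩
  have h1 := Nat.find_spec hex
  have heq : T.descCl u = (Finset.Ico u (Nat.find hex) : Set ℕ) := by
    ext x
    rw [Finset.coe_Ico, Set.mem_Ico]
    constructor
    · intro hx
      refine ⟨le_of_mem hx, ?_⟩
      by_contra hc
      exact h1.2 (mem_descCl_of_le hx h1.1 (by omega))
    · rintro ⟨hx, hx'⟩
      have := Nat.find_min hex hx'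
      tauto
  rw [heq, Set.ncard_coe_finset, Nat.card_Ico, Finset.coe_Ico, Set.mem_Ico]
  omega

lemma exists_ancestor {w ℓ : ℕ} (hw : w < N) (h : ℓ ≤ T.level w) :
    ∃ s, w ∈ T.descCl s ∧ T.level s = ℓ := by
  induction w using Nat.strong_induction_on with
  | _ w ih =>
    rcases h.eq_or_lt with h | h
    · exact ⟨w, T.self_mem_descCl hw, h.symm⟩
    have hpos : 0 < w := by
      refine Nat.pos_of_ne_zero ?_
      rintro rfl
      rw [T.level_zero] at h
      omega
    have h1 := T.parent_lt w hpos hw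
    have h2 := T.level_parent hpos hw
    obtain ⟨s, hs, hs'⟩ := ih _ h1 (h1.trans hw) (by omega)
    exact ⟨s, mem_descCl_trans (mem_descCl_parent hw) hs, hs'⟩

/-- A vertex at the level of `U` with a descendant strictly between `lo` and the end of the
descendants of `U` is `lo` or `U`. -/
lemma eq_or_eq_of_mem {U lo s w : ℕ} (hU : U < N) (hlo : lo = U ∨ IsLeft T.level lo U)
    (hs : T.level s = T.level U) (hw : w ∈ T.descCl s) (h1 : lo < w)
    (h2 : w < U + (T.descCl U).ncard) : s = lo ∨ s = U := by
  have hsw := le_of_mem hw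
  have hls : lo ≤ s := by
    by_contra hc
    have h3 := lt_and_level_lt (mem_descCl_of_le hw (by omega) h1.le) (by omega)
    rcases hlo with rfl | h
    · omega
    · have := h.2.1
      omega
  by_contra hc
  rw [not_or] at hc
  rcases lt_trichotomy s U with h | h | h
  · rcases hlo with rfl | h'
    · omega
    · exact h'.2.2 s (by omega) h hs
  · exact hc.2 h
  · have := lt_and_level_lt ((mem_descCl_iff (T := T) hU).2 ⟨h.le, by omega⟩) h.ne'
    omega

lemma graph_adj_of_arc {h u w : ℕ} (hu : u < N) (hw : w < N) (hne : u ≠ w) (ha : T.Arc h u w) :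
    (T.graph h).Adj u w := by
  rw [graph, SimpleGraph.fromRel_adj]
  exact ⟨hne, Or.inl ⟨hu, hw, ha⟩⟩

lemma graph_adj_of_mem {h u w : ℕ} (hw : w ∈ T.descCl u) (hne : w ≠ u) :
    (T.graph h).Adj u w :=
  graph_adj_of_arc ((le_of_mem hw).trans_lt hw.1) hw.1 hne.symm (Or.inl ⟨hw, hne⟩)

lemma graph_adj_dom {h U lo q w : ℕ} (hU : U < N) (hlo : lo = U ∨ IsLeft T.level lo U)
    (hq1 : lo < q) (hq2 : q < U + (T.descCl U).ncard) (hq : T.level q = T.level U + 1)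
    (hw1 : lo < w) (hw2 : w < q + (T.descCl q).ncard) (hw : T.level U + 1 ≤ T.level w)
    (hne : w ≠ q) : (T.graph h).Adj q w := by
  have hqN : q < N := by
    by_cases hqU : q ≤ U
    · omega
    · exact ((mem_descCl_iff hU).2 ⟨by omega, hq2⟩).1
  rcases hne.lt_or_gt with hwq | hwq
  swap
  · exact graph_adj_of_mem ((mem_descCl_iff hqN).2 ⟨hwq.le, hw2⟩) hne
  have hwN := hwq.trans hqN
  have hpq := T.level_parent (by omega) hqN
  obtain ⟨c, hwc, hc⟩ := exists_ancestor hwN hw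
  have hcw := le_of_mem hwc
  have hcN := hcw.trans_lt hwN
  have hc0 : 0 < c := by
    refine Nat.pos_of_ne_zero ?_
    rintro rfl
    rw [T.level_zero] at hc
    omega
  have hpc := T.level_parent hc0 hcN
  have hws : w ∈ T.descCl (T.parent c) := mem_descCl_trans hwc (mem_descCl_parent hcN)
  have e1 := eq_or_eq_of_mem hU hlo (by omega) (mem_descCl_parent hqN) hq1 hq2
  have e2 := eq_or_eq_of_mem hU hlo (by omega) hws hw1 (by omega)
  refine graph_adj_of_arc hqN hwN hne.symm (Or.inr ?_)
  by_cases heq : T.parent c = T.parent q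
  · refine Or.inl ⟨c, ⟨hc0, by omega, heq⟩, ?_⟩
    by_cases hwc' : w = c
    · exact Or.inl hwc'
    · exact Or.inr ⟨hwc, hwc'⟩
  · have hne' : lo ≠ U := by
      rintro rfl
      omega
    have hl := hlo.resolve_left hne'
    rcases e1 with e1 | e1
    · exfalso
      have e3 : T.parent c = U := e2.resolve_left fun e => heq (e.trans e1.symm)
      have h3 := le_of_mem hws
      have h4 := mem_descCl_of_le (mem_descCl_parent hqN) (x := U) (by rw [e1]; exact hl.1.le)
        (by omega)
      rw [e1] at h4
      have := lt_and_level_lt h4 hne'.symm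
      have := hl.2.1
      omega
    · have e3 : T.parent c = lo := e2.resolve_right fun e => heq (e.trans e1.symm)
      rw [e3] at hws
      exact Or.inr (Or.inl ⟨by omega, lo, e1 ▸ hl, Or.inr ⟨hws, by omega⟩⟩)

lemma graph_adj_near {h a u q : ℕ} (hu : u < N) (hl : IsLeft T.level a u) (h1 : a < q)
    (h2 : q < u + (T.descCl u).ncard) (hq : T.level q = T.level u + 1) :
    (T.graph h).Adj q a := by
  have hqN : q < N := by
    by_cases hqU : q ≤ u
    · omega
    · exact ((mem_descCl_iff hu).2 ⟨by omega, h2⟩).1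
  have hpq := T.level_parent (by omega) hqN
  rcases eq_or_eq_of_mem hu (Or.inr hl) (by omega) (mem_descCl_parent hqN) h1 h2 with e | e
  · exact (graph_adj_of_mem (e ▸ mem_descCl_parent hqN) h1.ne').symm
  · exact graph_adj_of_arc hqN (h1.trans hqN) h1.ne'
      (Or.inr (Or.inr (Or.inl ⟨by omega, a, e ▸ hl, Or.inl rfl⟩)))

lemma level_end_le {u : ℕ} (hu : u < N) (h : u + (T.descCl u).ncard < N) :
    T.level (u + (T.descCl u).ncard) ≤ T.level u := by
  have hpos : 1 ≤ (T.descCl u).ncard := by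
    have := (mem_descCl_iff hu).1 (T.self_mem_descCl hu)
    omega
  obtain ⟨w, hw⟩ : ∃ w, u + (T.descCl u).ncard = w + 1 := ⟨u + (T.descCl u).ncard - 1, by omega⟩
  have hwu : w ∈ T.descCl u := (mem_descCl_iff hu).2 ⟨by omega, by omega⟩
  have hwu' : w + 1 ∉ T.descCl u := fun h' => by
    have := (mem_descCl_iff hu).1 h'
    omega
  rw [hw] at h ⊢
  have hp := T.level_parent (by omega) h
  have hpu : T.parent (w + 1) ∉ T.descCl u := fun h' =>
    hwu' (mem_descCl_trans (mem_descCl_parent h) h')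
  have hwp : w ∈ T.descCl (T.parent (w + 1)) :=
    ⟨by omega, T.preorder_chain (w + 1) (by omega) h⟩
  have hlt := T.parent_lt (w + 1) (by omega) h
  have hup : T.parent (w + 1) < u := by
    by_contra hc
    exact hpu (mem_descCl_of_le hwu (by omega) (by omega))
  have := lt_and_level_lt (mem_descCl_of_le hwp hup.le (le_of_mem hwu)) hup.ne'
  omega

lemma level_succ_le {j : ℕ} (h : j + 1 < N) : T.level (j + 1) ≤ T.level j + 1 := by
  have hp := T.level_parent (by omega) h
  have hj : j ∈ T.descCl (T.parent (j + 1)) :=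
    ⟨by omega, T.preorder_chain (j + 1) (by omega) h⟩
  by_cases he : j = T.parent (j + 1)
  · rw [← he] at hp
    exact hp.le
  · have := lt_and_level_lt hj he
    omega

lemma add_ncard_le {u : ℕ} (hu : u < N) : u + (T.descCl u).ncard ≤ N := by
  by_contra hc
  exact ((mem_descCl_iff (T := T) (w := N) hu).2 ⟨hu.le, by omega⟩).1.false

/-- A `(4, 1)`-tree together with its 2-generated graph is a host. -/
noncomputable def toHost (T : DFSTree N) (hT : T.IsKSTree 4 1) : Host N where
  L := T.level
  sz u := (T.descCl u).ncard
  G := T.graph 2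
  sz_pos u hu := by
    have := (mem_descCl_iff hu).1 (T.self_mem_descCl hu)
    omega
  sz_le u hu := add_ncard_le hu
  lt_level u w hu h1 h2 :=
    (lt_and_level_lt ((mem_descCl_iff hu).2 ⟨h1.le, h2⟩) h1.ne').2
  end_level u hu h := level_end_le hu h
  step_level j h := level_succ_le h
  dom U lo q w hU hlo h1 h2 h3 h4 h5 h6 h7 := graph_adj_dom hU hlo h1 h2 h3 h4 h5 h6 h7
  near a u q hu hl h1 h2 h3 := graph_adj_near hu hl h1 h2 h3
  desc a w ha h1 h2 := graph_adj_of_mem ((mem_descCl_iff ha).2 ⟨h1.le, h2⟩) h1.ne'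
  sz_le_add a b u hu h h' := (hT u hu).1 a b h h'
  sz_le_mul a u hu h := (hT u hu).2.1 a h
  sz_mono a u u' hu h hu' h' :=
    (hT a (h.1.trans hu)).2.2.1 ⟨u, h.1, hu, h.2.1.symm⟩ u' hu' h'

end DFSTree

/-- For every `n ≥ 1` and every `n`-vertex `(4,1)`-tree `T`, the `2`-generated graph `G²_T`
contains every tree on `n` vertices. -/
theorem statement5 (N : ℕ) (hN : 1 ≤ N) (T : DFSTree N) (hT : T.IsKSTree 4 1)
    (T' : SimpleGraph (Fin N)) (hT' : T'.IsTree) :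
    ∃ f : Fin N → ℕ, Function.Injective f ∧ (∀ a, f a < N) ∧
      ∀ a b, T'.Adj a b → (T.graph 2).Adj (f a) (f b) := by
  refine (T.toHost hT).contains_tree hN ?_ hT' (Fintype.card_fin N)
  have h1 : N - 1 < N := by omega
  have h2 := (DFSTree.mem_descCl_iff (T := T) (u := 0) (w := N - 1) hN).1
    ⟨h1, T.exists_iterate_eq_zero h1⟩
  have h3 := DFSTree.add_ncard_le (T := T) (u := 0) hN
  change (T.descCl 0).ncard = N
  omega
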